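/- arXiv:0709.0715 — 4 statements merged into one kernel-verified Lean document; each statement's English description precedes it below -/
import Mathlib

section
/- Let k = F_q with q odd, V = k³ with basis e₁,e₂,e₃, and let GO₃(q) be the orthogonal group of the quadratic form 2x₁x₃ + x₂². Then the point stabilizer of the line ⟨e₃⟩ in GO₃(q) consists exactly of the matrices [[1,0,0],[-b,a,0],[-b²/2, ab, 1]] with a,b ∈ F_q and a² = 1. -/
open Matrix

/-- For `q` odd, the point stabilizer of the line `⟨e₃⟩` in `GO₃(q)`, the
orthogonal group of the quadratic form `2x₁x₃ + x₂²`, consists exactly of the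
matrices `[[1,0,0],[-b,a,0],[-b²/2, ab, 1]]` with `a² = 1`. -/
theorem pointStabilizer_GO3
    (p r : ℕ) [Fact p.Prime] (hr : 0 < r) (q : ℕ) (hq : q = p ^ r) (hodd : Odd q)
    (k : Type) [Field k] [Fintype k] (hk : Fintype.card k = q) :
    {g : Matrix (Fin 3) (Fin 3) k |
        IsUnit g ∧
        (∀ v : Fin 3 → k,
          2 * (g *ᵥ v) 0 * (g *ᵥ v) 2 + ((g *ᵥ v) 1) ^ 2 =
            2 * v 0 * v 2 + (v 1) ^ 2) ∧
        ∀ u ∈ Submodule.span k {(Pi.single 2 1 : Fin 3 → k)}, g *ᵥ u = u} =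
      {g | ∃ a b : k, a ^ 2 = 1 ∧
        g = !![1, 0, 0; -b, a, 0; -(b ^ 2 / 2), a * b, 1]} := by
  have h2 : (2 : k) ≠ 0 := by
    refine Ring.two_ne_zero fun hchar => ?_
    have heven := FiniteField.even_card_of_char_two hchar
    rw [← hk, Nat.odd_iff] at hodd
    omega
  ext g
  simp only [Set.mem_ofPred_eq]
  constructor
  · rintro ⟨-, hQ, hfix⟩
    have he₃ := hfix _ (Submodule.mem_span_singleton_self _)
    have h02 : g 0 2 = 0 := by simpa using congrFun he₃ 0
    have h12 : g 1 2 = 0 := by simpa using congrFun he₃ 1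
    have h22 : g 2 2 = 1 := by simpa using congrFun he₃ 2
    have hQ₁ := hQ ![1, 0, 0]
    have hQ₂ := hQ ![0, 1, 0]
    have hQ₁₃ := hQ ![1, 0, 1]
    have hQ₂₃ := hQ ![0, 1, 1]
    have hQ₁₂ := hQ ![1, 1, 0]
    simp [Matrix.mulVec, dotProduct, Fin.sum_univ_three, h02, h12, h22]
      at hQ₁ hQ₂ hQ₁₃ hQ₂₃ hQ₁₂
    have h00 : g 0 0 = 1 := mul_left_cancel₀ h2 (by linear_combination hQ₁₃ - hQ₁)
    have h01 : g 0 1 = 0 := mul_left_cancel₀ h2 (by linear_combination hQ₂₃ - hQ₂)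
    simp only [h00, h01] at hQ₁ hQ₂ hQ₁₂
    have h11 : g 1 1 ^ 2 = 1 := by linear_combination hQ₂
    have h20 : g 2 0 = -((-g 1 0) ^ 2 / 2) := by
      field_simp
      linear_combination hQ₁
    have h21 : g 2 1 = g 1 1 * -g 1 0 :=
      mul_left_cancel₀ h2 (by linear_combination hQ₁₂ - hQ₁ - hQ₂)
    refine ⟨g 1 1, -g 1 0, h11, ?_⟩
    ext i j
    fin_cases i <;> fin_cases j <;> simp [h00, h01, h02, h12, h22, h21]
    simpa using h20
  · rintro ⟨a, b, ha, rfl⟩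
    refine ⟨?_, fun v => ?_, fun u hu => ?_⟩
    · rw [Matrix.isUnit_iff_isUnit_det, isUnit_iff_ne_zero]
      have ha₀ : a ≠ 0 := by
        rintro rfl
        simp at ha
      simpa [Matrix.det_fin_three] using ha₀
    · simp [Matrix.mulVec, dotProduct, Fin.sum_univ_three]
      field_simp
      linear_combination (v 1 ^ 2) * ha
    · obtain ⟨c, rfl⟩ := Submodule.mem_span_singleton.mp hu
      ext i
      fin_cases i <;> simp [Matrix.mulVec, dotProduct, Fin.sum_univ_three]
end

section
/- Let k be a field of characteristic p > 0, m = pm' ≥ 5 a multiple of p, and W = k^m with basis e₁,…,e_m on which the symmetric group S_m acts by permuting basis vectors. Let Ṽ = ⟨e_i - e_j : 1 ≤ i < j ≤ m⟩, v = Σ_{i=1}^m e_i ∈ Ṽ, and V = Ṽ/⟨v⟩. For 1 ≤ j ≤ m' set v_j = Σ_{i=1}^p e_{p(j-1)+i} and let U₁ ⊆ V be the image of ⟨v₁,…,v_{m'}⟩. Then the point stabilizer of U₁ in S_m acting on V is the Young subgroup S_{{1,…,p}} × S_{{p+1,…,2p}} × ⋯ × S_{{(m'-1)p+1,…,m'p}}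 ≅ (S_p)^{m'}. -/
open Matrix

section SymmetricSetup

variable (k : Type) [Field k] (m : ℕ)

/-- The standard basis vector `e i` of `W = k^m`. -/
def stdVec (i : Fin m) : Fin m → k := Pi.single i 1

/-- The submodule `Ṽ = ⟨e_i - e_j : 1 ≤ i < j ≤ m⟩` of `W`. -/
def Vtil : Submodule k (Fin m → k) :=
  Submodule.span k {x | ∃ i j : Fin m, i < j ∧ x = stdVec k m i - stdVec k m j}

/-- `v = Σ_{i=1}^m e_i`. -/
def vvec : Fin m → k := ∑ i, stdVec k m i

/-- The action of a permutation on `W = k^m`, permuting the basis vectors: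
`e_i ↦ e_{σ i}`, i.e. `(σ • w) j = w (σ⁻¹ j)`. -/
def permT (σ : Equiv.Perm (Fin m)) : (Fin m → k) →ₗ[k] (Fin m → k) :=
  LinearMap.funLeft k k ⇑σ.symm

lemma permT_stdVec (σ : Equiv.Perm (Fin m)) (i : Fin m) :
    permT k m σ (stdVec k m i) = stdVec k m (σ i) := by
  ext j
  simp [permT, stdVec, LinearMap.funLeft, Pi.single_apply, Equiv.symm_apply_eq]

lemma stdVec_sub_mem (a b : Fin m) : stdVec k m a - stdVec k m b ∈ Vtil k m := by
  rcases lt_trichotomy a b with h | h | h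
  · exact Submodule.subset_span ⟨a, b, h, rfl⟩
  · simp [h, sub_self, Submodule.zero_mem]
  · have : stdVec k m b - stdVec k m a ∈ Vtil k m :=
      Submodule.subset_span ⟨b, a, h, rfl⟩
    simpa using Submodule.neg_mem _ this

lemma permT_mem_Vtil (σ : Equiv.Perm (Fin m)) :
    ∀ x ∈ Vtil k m, permT k m σ x ∈ Vtil k m := by
  intro x hx
  induction hx using Submodule.span_induction with
  | mem x hx =>
    obtain ⟨i, j, _, rfl⟩ := hx
    rw [map_sub, permT_stdVec, permT_stdVec]
    exact stdVec_sub_mem k m _ _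
  | zero => simp [Submodule.zero_mem]
  | add x y _ _ hx hy => rw [map_add]; exact Submodule.add_mem _ hx hy
  | smul c x _ hx => rw [_root_.map_smul]; exact Submodule.smul_mem _ _ hx

lemma permT_vvec (σ : Equiv.Perm (Fin m)) : permT k m σ (vvec k m) = vvec k m := by
  rw [vvec, map_sum]
  simp_rw [permT_stdVec]
  exact Equiv.sum_comp σ (stdVec k m)

/-- The submodule `⟨v⟩` of `Ṽ`. -/
def Zv : Submodule k (Vtil k m) :=
  Submodule.span k {x : Vtil k m | (x : Fin m → k) = vvec k m}

/-- The `S_m`-representation `V = Ṽ/⟨v⟩`. -/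
abbrev Vquot := Vtil k m ⧸ Zv k m

/-- The induced action of a permutation on `V = Ṽ/⟨v⟩`. -/
def rho (σ : Equiv.Perm (Fin m)) : Vquot k m →ₗ[k] Vquot k m :=
  Submodule.mapQ (Zv k m) (Zv k m)
    ((permT k m σ).restrict (permT_mem_Vtil k m σ))
    (by
      rw [Zv, Submodule.span_le]
      intro x hx
      refine Submodule.subset_span ?_
      show (((permT k m σ).restrict (permT_mem_Vtil k m σ) x : Vtil k m) : Fin m → k)
        = vvec k m
      rw [LinearMap.restrict_coe_apply]
      rw [show (x : Fin m → k) = vvec k m from hx]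
      exact permT_vvec k m σ)

end SymmetricSetup

/-- `v_j = Σ_{i=1}^p e_{p(j-1)+i}`, the sum of the basis vectors in the `j`-th
block of size `p`. -/
def vj (k : Type) [Field k] (p m' : ℕ) (j : Fin m') : Fin (p * m') → k :=
  ∑ i : Fin p, stdVec k (p * m')
    ⟨p * (j : ℕ) + (i : ℕ), by
      have h1 := i.isLt
      have h2 : (j : ℕ) + 1 ≤ m' := j.isLt
      have h3 : p * ((j : ℕ) + 1) ≤ p * m' := Nat.mul_le_mul_left p h2
      rw [Nat.mul_succ] at h3
      omega⟩

/-- `U₁`, the image in `V = Ṽ/⟨v⟩` of `⟨v₁,…,v_{m'}⟩`. -/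
def U1 (k : Type) [Field k] (p m' : ℕ) : Submodule k (Vquot k (p * m')) :=
  Submodule.map (Zv k (p * m')).mkQ
    (Submodule.span k
      {x : Vtil k (p * m') | ∃ j : Fin m', (x : Fin (p * m') → k) = vj k p m' j})

lemma vj_apply (k : Type) [Field k] (p m' : ℕ) (hp : 0 < p) (j : Fin m')
    (x : Fin (p * m')) : vj k p m' j x = if (x : ℕ) / p = j then 1 else 0 := by
  simp only [vj, Finset.sum_apply, stdVec, Pi.single_apply]
  split_ifs with h
  · have hx : p * (j : ℕ) + (x : ℕ) % p = x := h ▸ Nat.div_add_mod _ p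
    rw [Finset.sum_eq_single ⟨(x : ℕ) % p, Nat.mod_lt _ hp⟩]
    · rw [if_pos (Fin.ext hx.symm)]
    · intro b _ hb
      refine if_neg fun hxb => hb (Fin.ext ?_)
      have := congrArg Fin.val hxb
      simp only at this ⊢
      omega
    · simp
  · refine Finset.sum_eq_zero fun i _ => if_neg fun hxi => h ?_
    rw [hxi, Nat.mul_add_div hp, Nat.div_eq_of_lt i.isLt, add_zero]

lemma vj_mem_Vtil (k : Type) [Field k] (p : ℕ) [Fact p.Prime] [CharP k p]
    (m' : ℕ) (j : Fin m') : vj k p m' j ∈ Vtil k (p * m') := by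
  have hlt : p * (j : ℕ) < p * m' :=
    Nat.mul_lt_mul_of_pos_left j.isLt (Fact.out : p.Prime).pos
  have hzero : ∑ _i : Fin p, stdVec k (p * m') ⟨p * (j : ℕ), hlt⟩ = 0 := by
    rw [Finset.sum_const, Finset.card_univ, Fintype.card_fin, ← Nat.cast_smul_eq_nsmul k,
      CharP.cast_eq_zero, zero_smul]
  rw [vj, ← sub_zero (∑ i : Fin p, _), ← hzero, ← Finset.sum_sub_distrib]
  exact Submodule.sum_mem _ fun i _ => stdVec_sub_mem k _ _ _

lemma vvec_apply (k : Type) [Field k] (m : ℕ) (x : Fin m) : vvec k m x = 1 := by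
  simp [vvec, stdVec, Pi.single_apply]

lemma exists_apply_eq_of_mem_Zv (k : Type) [Field k] (m : ℕ) {x : Vtil k m}
    (hx : x ∈ Zv k m) : ∃ c : k, ∀ i, (x : Fin m → k) i = c := by
  induction hx using Submodule.span_induction with
  | mem x hx => exact ⟨1, fun i => (congrFun hx i).trans (vvec_apply k m i)⟩
  | zero => exact ⟨0, fun i => rfl⟩
  | add x y _ _ hx hy =>
    obtain ⟨a, ha⟩ := hx
    obtain ⟨b, hb⟩ := hy
    exact ⟨a + b, fun i => congrArg₂ (· + ·) (ha i) (hb i)⟩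
  | smul c x _ hx =>
    obtain ⟨a, ha⟩ := hx
    exact ⟨c * a, fun i => congrArg (c * ·) (ha i)⟩

lemma permT_apply (k : Type) [Field k] (m : ℕ) (σ : Equiv.Perm (Fin m)) (w : Fin m → k)
    (i : Fin m) : permT k m σ w (σ i) = w i := by
  simp [permT, LinearMap.funLeft]

lemma rho_mkQ (k : Type) [Field k] (m : ℕ) (σ : Equiv.Perm (Fin m)) (x : Vtil k m) :
    rho k m σ ((Zv k m).mkQ x) =
      (Zv k m).mkQ ((permT k m σ).restrict (permT_mem_Vtil k m σ) x) := rfl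

lemma card_filter_div_eq_le (n p j : ℕ) (hp : 0 < p) :
    (Finset.univ.filter fun x : Fin n => (x : ℕ) / p = j).card ≤ p := by
  calc _ ≤ (Finset.Ico (j * p) (j * p + p)).card := by
        refine Finset.card_le_card_of_injOn Fin.val (fun x hx => ?_)
          Fin.val_injective.injOn
        have hx' : (x : ℕ) / p = j := by simpa using hx
        have hmod := Nat.div_add_mod' (x : ℕ) p
        have hlt := Nat.mod_lt (x : ℕ) hp
        rw [hx'] at hmod
        simp only [Finset.coe_Ico, Set.mem_Ico]
        omega
    _ = p := by simp

/-- A permutation cannot send the complement of a block into that block when `n > 2 * p`. -/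
lemma exists_div_ne_and_apply_div_ne (n p j : ℕ) (hp : 0 < p) (hn : 2 * p < n)
    (σ : Equiv.Perm (Fin n)) :
    ∃ i : Fin n, (i : ℕ) / p ≠ j ∧ (σ i : ℕ) / p ≠ j := by
  by_contra! h
  have hcompl : (Finset.univ.filter fun x : Fin n => ¬(x : ℕ) / p = j).card ≤
      (Finset.univ.filter fun x : Fin n => (x : ℕ) / p = j).card :=
    Finset.card_le_card_of_injOn σ (fun x hx => by simpa using h x (by simpa using hx))
      σ.injective.injOn
  have hcard := card_filter_div_eq_le n p j hp
  have htotal := Finset.card_filter_add_card_filter_not (s := (Finset.univ : Finset (Fin n)))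
    (fun x : Fin n => (x : ℕ) / p = j)
  rw [Finset.card_univ, Fintype.card_fin] at htotal
  omega

/-- The point stabilizer of `U₁` in `S_m` acting on `V = Ṽ/⟨v⟩` (where
`m = pm'` and `char k = p`) is the Young subgroup
`S_{{1,…,p}} × S_{{p+1,…,2p}} × ⋯ × S_{{(m'-1)p+1,…,m'p}} ≅ (S_p)^{m'}`,
i.e. the permutations preserving each of the `m'` consecutive blocks of
size `p`. -/
theorem pointStabilizer_U1_eq_youngSubgroup
    (k : Type) [Field k] (p : ℕ) [Fact p.Prime] [CharP k p]
    (m' : ℕ) (hm : 5 ≤ p * m') :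
    {σ : Equiv.Perm (Fin (p * m')) |
        ∀ x ∈ U1 k p m', rho k (p * m') σ x = x} =
      {σ : Equiv.Perm (Fin (p * m')) |
        ∀ i : Fin (p * m'), ((σ i : ℕ)) / p = ((i : ℕ)) / p} := by
  have hp : p.Prime := Fact.out
  ext σ
  simp only [Set.mem_ofPred_eq]
  constructor
  · intro h i
    have hj : (i : ℕ) / p < m' := Nat.div_lt_of_lt_mul i.isLt
    set j : Fin m' := ⟨(i : ℕ) / p, hj⟩
    have hfix := h _ (Submodule.mem_map_of_mem (Submodule.subset_span
      (show (⟨vj k p m' j, vj_mem_Vtil k p m' j⟩ : Vtil k (p * m')) ∈ _ from ⟨j, rfl⟩)))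
    rw [rho_mkQ, ← sub_eq_zero, ← map_sub, Submodule.mkQ_apply,
      Submodule.Quotient.mk_eq_zero] at hfix
    obtain ⟨c, hc⟩ := exists_apply_eq_of_mem_Zv k _ hfix
    have hdiff (x : Fin (p * m')) : (if (x : ℕ) / p = (i : ℕ) / p then (1 : k) else 0) -
        (if (σ x : ℕ) / p = (i : ℕ) / p then 1 else 0) = c := by
      rw [← hc (σ x), Submodule.coe_sub, Pi.sub_apply, LinearMap.coe_restrict_apply,
        permT_apply]
      exact (congrArg₂ (· - ·) (vj_apply k p m' hp.pos j x)
        (vj_apply k p m' hp.pos j (σ x))).symm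
    by_contra hi
    have hc1 : c = 1 := by simpa [hi] using (hdiff i).symm
    by_cases hbig : 2 * p < p * m'
    · obtain ⟨x, hx, hσx⟩ := exists_div_ne_and_apply_div_ne _ p ((i : ℕ) / p) hp.pos hbig σ
      have := hdiff x
      simp [hx, hσx, hc1] at this
    · have hp2 : p ≠ 2 := by
        rintro rfl
        omega
      have hne := hdiff (σ i)
      have htwo : (2 : k) ≠ 0 := Ring.two_ne_zero
        (by rwa [← CharP.eq k ‹CharP k p› (ringChar.charP k)])
      rw [hc1, if_neg hi] at hne
      split_ifs at hne
      · exact htwo (by linear_combination -hne)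
      · simp at hne
  · rintro h _ ⟨x, hx, rfl⟩
    rw [rho_mkQ]
    congr 1
    induction hx using Submodule.span_induction with
    | mem x hx =>
      obtain ⟨j, hj⟩ := hx
      ext i
      obtain ⟨i, rfl⟩ := σ.surjective i
      rw [LinearMap.coe_restrict_apply, permT_apply, hj, vj_apply k p m' hp.pos,
        vj_apply k p m' hp.pos, h]
    | zero => exact map_zero _
    | add x y _ _ hx hy => rw [map_add, hx, hy]
    | smul c x _ hx => rw [map_smul, hx]
end

section
/- Let k = F_q, m ≥ 2, and let Sp_{2m}(q) ≤ GL_{2m}(F_q) be the symplectic group, i.e. the matrices g with gᵀ J g = J for J = [[O,I],[-I,O]]. Then the natural action of Sp_{2m}(q) on V = F_q^{2m} does not have the direct summand property. -/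
open MvPolynomial Matrix

set_option synthInstance.maxHeartbeats 1000000
set_option maxHeartbeats 1000000

variable {k : Type} [Field k] {ι : Type} [Fintype ι] [DecidableEq ι]

/-- Substitution of the variables by the linear forms determined by the matrix `g`. -/
noncomputable def polySub (g : Matrix ι ι k) :
    MvPolynomial ι k →ₐ[k] MvPolynomial ι k :=
  aeval fun i => ∑ j, C (g i j) * X j

/-- The (left) action of an invertible matrix `g` on polynomial functions,
`(g • f)(v) = f (g⁻¹ *ᵥ v)`. -/
noncomputable def polyAct (g : Matrix ι ι k) :
    MvPolynomial ι k →ₐ[k] MvPolynomial ι k :=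
  polySub g⁻¹

/-- The ring of invariants of a set of (invertible) matrices. -/
noncomputable def invariantRing (S : Set (Matrix ι ι k)) :
    Subalgebra k (MvPolynomial ι k) :=
  ⨅ g ∈ S, AlgHom.equalizer (polyAct g) (AlgHom.id k _)

/-- The direct summand property: there is a surjective `k[V]^G`-linear map
`k[V] → k[V]^G` respecting the gradings. -/
noncomputable def DirectSummand (S : Set (Matrix ι ι k)) : Prop :=
  ∃ π : MvPolynomial ι k →ₗ[invariantRing S] invariantRing S,
    Function.Surjective π ∧
    ∀ (d : ℕ) (f : MvPolynomial ι k),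
      f.IsHomogeneous d → ((π f : MvPolynomial ι k)).IsHomogeneous d

/-- Coregularity: the invariant ring is generated by `dim V` algebraically
independent homogeneous invariants. -/
noncomputable def Coregular (S : Set (Matrix ι ι k)) : Prop :=
  ∃ f : ι → MvPolynomial ι k,
    (∀ i, ∃ d, (f i).IsHomogeneous d) ∧
    AlgebraicIndependent k f ∧
    Algebra.adjoin k (Set.range f) = invariantRing S

/-- A pseudo-reflection: fixed-point space of codimension one. -/
def IsPseudoReflection (g : Matrix ι ι k) : Prop :=
  Module.finrank k (LinearMap.ker (g.mulVecLin - LinearMap.id)) + 1 = Fintype.card ι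

/-- The set of matrices underlying a subgroup of `GL`. -/
def matSet {n : ℕ} (G : Subgroup (GL (Fin n) k)) : Set (Matrix (Fin n) (Fin n) k) :=
  (fun g : GL (Fin n) k => (g : Matrix (Fin n) (Fin n) k)) '' (G : Set (GL (Fin n) k))

/-- The point stabilizer of a subspace `U`. -/
def pointStabilizer {n : ℕ} (G : Subgroup (GL (Fin n) k)) (U : Submodule k (Fin n → k)) :
    Subgroup (GL (Fin n) k) where
  carrier := {g | g ∈ G ∧ ∀ u ∈ U, (g : Matrix (Fin n) (Fin n) k) *ᵥ u = u}
  one_mem' := ⟨G.one_mem, fun u _ => by simp⟩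
  mul_mem' := fun {a b} ha hb => ⟨G.mul_mem ha.1 hb.1, fun u hu => by
    have h1 := ha.2 u hu
    have h2 := hb.2 u hu
    rw [Units.val_mul, ← Matrix.mulVec_mulVec, h2, h1]⟩
  inv_mem' := fun {a} ha => ⟨G.inv_mem ha.1, fun u hu => by
    conv_lhs => rw [← ha.2 u hu]
    rw [Matrix.mulVec_mulVec, Units.inv_mul, Matrix.one_mulVec]⟩

/-- The symplectic group `Sp_{2m}(q)`: matrices `g` with `gᵀ J g = J` for
`J = [[O,I],[-I,O]]`. -/
def SpSet (m : ℕ) (k : Type) [Field k] :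
    Set (Matrix (Fin m ⊕ Fin m) (Fin m ⊕ Fin m) k) :=
  {g | IsUnit g ∧
    g.transpose * Matrix.fromBlocks 0 1 (-1) 0 * g = Matrix.fromBlocks 0 1 (-1) 0}

section Shear

lemma polySub_X {σ : Type} [Fintype σ] (g : Matrix σ σ k) (i : σ) :
    polySub g (X i) = ∑ j, C (g i j) * X j := by
  simp [polySub]

lemma polySub_polySub {σ : Type} [Fintype σ] (g h : Matrix σ σ k) (f : MvPolynomial σ k) :
    polySub g (polySub h f) = polySub (h * g) f := by
  suffices H : (polySub g).comp (polySub h) = polySub (h * g) from DFunLike.congr_fun H f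
  refine MvPolynomial.algHom_ext fun i => ?_
  simp only [AlgHom.comp_apply, polySub_X, map_sum, map_mul, algHom_C, Matrix.mul_apply,
    Finset.sum_mul, Finset.mul_sum, MvPolynomial.algebraMap_eq]
  rw [Finset.sum_comm]
  simp only [mul_assoc]

lemma polySub_one (f : MvPolynomial ι k) : polySub (1 : Matrix ι ι k) f = f := by
  suffices H : polySub (1 : Matrix ι ι k) = AlgHom.id k _ from DFunLike.congr_fun H f
  refine MvPolynomial.algHom_ext fun i => ?_
  simp [polySub_X, Matrix.one_apply]

lemma mem_SpSet_iff {m : ℕ} {g : Matrix (Fin m ⊕ Fin m) (Fin m ⊕ Fin m) k} :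
    g ∈ SpSet m k ↔ g ∈ symplecticGroup (Fin m) k := by
  have hJ : (Matrix.fromBlocks 0 1 (-1) 0 : Matrix (Fin m ⊕ Fin m) (Fin m ⊕ Fin m) k) =
      -Matrix.J (Fin m) k := by
    simp [Matrix.J, Matrix.fromBlocks_neg]
  rw [SymplecticGroup.mem_iff', SpSet, Set.mem_ofPred_eq, hJ, Matrix.mul_neg, Matrix.neg_mul,
    neg_inj]
  refine ⟨And.right, fun h => ⟨?_, h⟩⟩
  exact (Matrix.isUnit_iff_isUnit_det g).2
    (SymplecticGroup.symplectic_det (SymplecticGroup.mem_iff'.2 h))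

lemma mem_invariantRing_SpSet {m : ℕ} {f : MvPolynomial (Fin m ⊕ Fin m) k} :
    f ∈ invariantRing (SpSet m k) ↔ ∀ g ∈ symplecticGroup (Fin m) k, polySub g f = f := by
  simp only [invariantRing, Algebra.mem_iInf, AlgHom.mem_equalizer, polyAct, mem_SpSet_iff,
    AlgHom.id_apply]
  refine ⟨fun h g hg => ?_, fun h g hg => ?_⟩
  · have := h _ (⟨g, hg⟩⁻¹ : symplecticGroup (Fin m) k).2
    rwa [← SymplecticGroup.coe_inv', inv_inv] at this
  · have := h _ (⟨g, hg⟩⁻¹ : symplecticGroup (Fin m) k).2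
    rwa [SymplecticGroup.coe_inv'] at this

lemma fromBlocks_shear_mem {m : ℕ} {S : Matrix (Fin m) (Fin m) k} (hS : S.IsSymm) :
    Matrix.fromBlocks 1 0 S 1 ∈ symplecticGroup (Fin m) k := by
  rw [SymplecticGroup.fromBlocks_mem_iff]
  simp [hS.eq]

end Shear

section Moore

variable [Fintype k]

/-- Raising to the power `|k| ^ n`, as an endomorphism of a commutative `k`-algebra. -/
noncomputable def frobeniusPow (R : Type*) [CommRing R] [Algebra k R] (n : ℕ) : R →ₐ[k] R :=
  FiniteField.frobeniusAlgHom k R ^ n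

lemma frobeniusPow_apply {R : Type*} [CommRing R] [Algebra k R] (n : ℕ) (x : R) :
    frobeniusPow (k := k) R n x = x ^ Fintype.card k ^ n := by
  rw [frobeniusPow, AlgHom.coe_pow, FiniteField.coe_frobeniusAlgHom, pow_iterate]

/-- The `|k|`-power Frobenius twists of a vector of indeterminates are linearly independent. -/
lemma eq_zero_of_sum_mul_X_pow_eq_zero {m : ℕ} (r : ℕ) (b : ℕ → MvPolynomial (Fin m) k)
    (h : ∀ j, ∑ i ∈ Finset.range m, b i * X j ^ Fintype.card k ^ (r + i) = 0) :
    ∀ i < m, b i = 0 := by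
  have hq : 1 < Fintype.card k := Fintype.one_lt_card
  set P : Polynomial (MvPolynomial (Fin m) k) :=
    ∑ i ∈ Finset.range m, Polynomial.C (b i) * Polynomial.X ^ Fintype.card k ^ i with hP
  set w : (Fin m → k) → MvPolynomial (Fin m) k :=
    fun c => ∑ j, C (c j) * X j ^ Fintype.card k ^ r with hw
  have hinj : Function.Injective w := by
    intro c d hcd
    funext l
    have := congrArg (coeff (Finsupp.single l (Fintype.card k ^ r))) hcd
    have hpos : Fintype.card k ^ r ≠ 0 := by positivity
    simpa [hw, coeff_sum, coeff_C_mul, coeff_X_pow, Finsupp.single_left_inj hpos] using this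
  have heval : ∀ c, P.eval (w c) = 0 := by
    intro c
    have hwc (i : ℕ) : w c ^ Fintype.card k ^ i =
        ∑ j, C (c j) * X j ^ Fintype.card k ^ (r + i) := by
      rw [← frobeniusPow_apply (k := k)]
      rw [map_sum]
      refine Finset.sum_congr rfl fun j _ => ?_
      rw [map_mul, algHom_C, frobeniusPow_apply, ← pow_mul, ← pow_add, MvPolynomial.algebraMap_eq]
    simp only [hP, Polynomial.eval_finsetSum, Polynomial.eval_mul, Polynomial.eval_C,
      Polynomial.eval_pow, Polynomial.eval_X, hwc, Finset.mul_sum]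
    rw [Finset.sum_comm]
    refine Finset.sum_eq_zero fun j _ => ?_
    have := congrArg (C (c j) * ·) (h j)
    simp only [Finset.mul_sum, mul_zero] at this
    rw [← this]
    exact Finset.sum_congr rfl fun i _ => by ring
  intro i hi
  have hdeg : P.natDegree < Fintype.card (Fin m → k) := by
    rw [Fintype.card_fun, Fintype.card_fin]
    refine lt_of_le_of_lt (Polynomial.natDegree_sum_le_of_forall_le (n := Fintype.card k ^ (m - 1))
      _ _ fun l hl => ?_) (Nat.pow_lt_pow_right hq (by omega))
    refine (Polynomial.natDegree_C_mul_X_pow_le _ _).trans ?_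
    exact Nat.pow_le_pow_right hq.le (by have := Finset.mem_range.1 hl; omega)
  have h0 := Polynomial.eq_zero_of_natDegree_lt_card_of_eval_eq_zero P hinj heval hdeg
  have := congrArg (Polynomial.coeff · (Fintype.card k ^ i)) h0
  simpa [hP, Polynomial.finsetSum_coeff, Polynomial.coeff_C_mul, Polynomial.coeff_X_pow,
    Nat.pow_right_inj hq, hi, (Nat.pow_right_injective hq).eq_iff] using this

end Moore

section Direction

lemma Polynomial.prod_X_sub_C_dvd_of_eval_eq_zero {R α : Type*} [CommRing R] [IsDomain R]
    [Fintype α] {a : α → R} (ha : Function.Injective a) {P : Polynomial R}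
    (h : ∀ i, P.eval (a i) = 0) : ∏ i, (Polynomial.X - Polynomial.C (a i)) ∣ P := by
  rcases eq_or_ne P 0 with rfl | hP
  · exact dvd_zero _
  have := (Multiset.prod_X_sub_C_dvd_iff_le_roots hP (Finset.univ.val.map a)).2
    ((Multiset.le_iff_subset (Finset.univ.nodup.map ha)).2 fun x hx => by
      obtain ⟨i, -, rfl⟩ := Multiset.mem_map.1 hx
      exact (Polynomial.mem_roots hP).2 (h i))
  rwa [Multiset.map_map] at this

/-- There is a separable quadratic polynomial `X ^ 2 - X + ν` without roots in a finite field. -/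
lemma exists_forall_sq_sub_self_add_ne_zero (k : Type*) [Field k] [Finite k] :
    ∃ ν : k, ∀ x : k, x ^ 2 - x + ν ≠ 0 := by
  have hni : ¬ Function.Injective fun x : k => x - x ^ 2 := fun h =>
    zero_ne_one (h (by simp : (0 : k) - 0 ^ 2 = 1 - 1 ^ 2))
  have hns := mt Finite.injective_iff_surjective.2 hni
  simp only [Function.Surjective, not_forall, not_exists] at hns
  obtain ⟨ν, hν⟩ := hns
  exact ⟨ν, fun x hx => hν x (by linear_combination -hx)⟩

/-- Restriction of polynomial functions to the Lagrangian subspace on which the first half of the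
coordinates vanishes. -/
noncomputable def restrictLagrangian (m : ℕ) (k : Type) [Field k] :
    MvPolynomial (Fin m ⊕ Fin m) k →ₐ[k] MvPolynomial (Fin m) k :=
  aeval (Sum.elim 0 X)

/-- Taylor expansion of a polynomial in the direction `u`. -/
noncomputable def taylorAlong {m : ℕ} {K : Type} [Field K] [Algebra k K] (u : Fin m → K) :
    MvPolynomial (Fin m) k →ₐ[k] Polynomial (MvPolynomial (Fin m) K) :=
  aeval fun j => Polynomial.C (X j) + Polynomial.C (C (u j)) * Polynomial.X

lemma coeff_zero_taylorAlong {m : ℕ} {K : Type} [Field K] [Algebra k K] (u : Fin m → K)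
    (f : MvPolynomial (Fin m) k) :
    (taylorAlong u f).coeff 0 = MvPolynomial.map (algebraMap k K) f := by
  rw [Polynomial.coeff_zero_eq_eval_zero]
  suffices H : ((Polynomial.aeval (0 : MvPolynomial (Fin m) K)).restrictScalars k).comp
      (taylorAlong (k := k) u) = mapAlgHom (Algebra.ofId k K) from by
    simpa using DFunLike.congr_fun H f
  exact MvPolynomial.algHom_ext fun j => by simp [taylorAlong]

/-- An invariant of the symplectic group, restricted to a Lagrangian subspace and expanded in the
direction `(s - 1, 1, 0, …, 0)` with `s` quadratic over `k`, has no terms of degree strictly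
between `0` and `|k| ^ 2`. -/
lemma coeff_taylorAlong_restrictLagrangian [Fintype k] {m : ℕ} {K : Type} [Field K] [Algebra k K]
    {ν : k} (hν : ∀ x : k, x ^ 2 - x + ν ≠ 0) {s : K} (hs : s ^ 2 - s + algebraMap k K ν = 0)
    {i₀ i₁ : Fin m} (hi : i₀ ≠ i₁) {f : MvPolynomial (Fin m ⊕ Fin m) k}
    (hf : f ∈ invariantRing (SpSet m k)) {d : ℕ} (hd : 0 < d) (hdq : d < Fintype.card k ^ 2) :
    (taylorAlong (Pi.single i₀ (s - 1) + Pi.single i₁ 1 : Fin m → K)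
      (restrictLagrangian m k f)).coeff d
      = 0 := by
  classical
  set u : Fin m → K := Pi.single i₀ (s - 1) + Pi.single i₁ 1 with hu
  set l : Fin m → K := Pi.single i₀ 1 + Pi.single i₁ s with hl
  let R := MvPolynomial (Fin m) K
  let Φ : MvPolynomial (Fin m ⊕ Fin m) k →ₐ[k] Polynomial (Polynomial R) :=
    aeval (Sum.elim (fun j => Polynomial.C (Polynomial.C (C (l j)) * Polynomial.X))
      (fun j => Polynomial.C (Polynomial.C (X j)) +
        Polynomial.C (Polynomial.C (C (u j))) * Polynomial.X))
  let e : k × k → K := fun bc => algebraMap k K bc.1 + algebraMap k K bc.2 * s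
  let a : k × k → Polynomial R := fun bc => Polynomial.C (C (e bc)) * Polynomial.X
  have he : Function.Injective e := by
    rintro ⟨b, c⟩ ⟨b₂, c₂⟩ h
    simp only [e] at h
    have hc : c = c₂ := by
      by_contra hne
      have hne' : algebraMap k K (c - c₂) ≠ 0 := by simpa [sub_eq_zero] using hne
      refine hν ((b₂ - b) / (c - c₂)) ((algebraMap k K).injective ?_)
      have hsx : s = algebraMap k K ((b₂ - b) / (c - c₂)) := by
        rw [map_div₀, eq_div_iff hne']
        simp only [map_sub]
        linear_combination h
      rw [map_zero, ← hs, hsx]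
      simp
    subst hc
    simpa using h
  have ha : Function.Injective a := fun x y h => he <| by
    simpa [a] using h
  have hinv (bc : k × k) : (Φ f).eval (a bc) = (Φ f).eval 0 := by
    obtain ⟨b, c⟩ := bc
    let S : Matrix (Fin m) (Fin m) k := Matrix.single i₀ i₀ (-b - c * ν) + Matrix.single i₀ i₁ b +
      Matrix.single i₁ i₀ b + Matrix.single i₁ i₁ c
    have hS : S.IsSymm := by
      simp only [Matrix.IsSymm, S, Matrix.transpose_add, Matrix.transpose_single]
      abel
    have hSl (j : Fin m) : ∑ i, algebraMap k K (S j i) * l i = e (b, c) * u j := by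
      have hsum (t : Fin m → K) : ∑ i, t i * l i = t i₀ + t i₁ * s := by
        simp [hl, mul_add, Finset.sum_add_distrib, Pi.single_apply]
      rw [hsum]
      by_cases h₀ : j = i₀
      · subst h₀
        simp [S, e, hu, hi, hi.symm]
        linear_combination (-algebraMap k K c) * hs
      by_cases h₁ : j = i₁
      · subst h₁
        simp [S, e, hu, hi, hi.symm]
      · simp [S, hu, h₀, h₁, Ne.symm h₀, Ne.symm h₁]
    have hSl' (j : Fin m) : ∑ i, Polynomial.C (C (algebraMap k K (S j i) * l i)) * Polynomial.X =
        Polynomial.C (C (u j)) * a (b, c) := by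
      rw [← Finset.sum_mul, ← map_sum, ← map_sum, hSl]
      simp only [a, C_mul, Polynomial.C_mul]
      ring
    suffices H : ((Polynomial.aeval (a (b, c))).restrictScalars k).comp Φ =
        (((Polynomial.aeval (0 : Polynomial R)).restrictScalars k).comp Φ).comp
          (polySub (Matrix.fromBlocks 1 0 S 1)) by
      have := DFunLike.congr_fun H f
      simp only [AlgHom.comp_apply,
        mem_invariantRing_SpSet.1 hf _ (fromBlocks_shear_mem hS)] at this
      simpa using this
    refine MvPolynomial.algHom_ext fun j => ?_
    rcases j with j | j
    · simp [polySub_X, Φ, Matrix.one_apply]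
    · simp [polySub_X, Φ, Matrix.one_apply]
      rw [Polynomial.eval_finsetSum, add_comm, ← hSl' j]
      simp [mul_assoc]
  have hdvd := Polynomial.prod_X_sub_C_dvd_of_eval_eq_zero ha
    (P := Φ f - Polynomial.C ((Φ f).eval 0)) fun bc => by simp [hinv bc]
  have hdvd' := Polynomial.map_dvd (Polynomial.evalRingHom (0 : R)) hdvd
  have hmap : (Φ f).map (Polynomial.evalRingHom (0 : R)) =
      taylorAlong u (restrictLagrangian m k f) := by
    suffices H : (Polynomial.mapAlgHom ((Polynomial.aeval (0 : R)).restrictScalars k)).comp Φ =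
        (taylorAlong (k := k) u).comp (restrictLagrangian m k) from DFunLike.congr_fun H f
    refine MvPolynomial.algHom_ext fun j => ?_
    rcases j with j | j <;> simp [Φ, taylorAlong, restrictLagrangian]
  rw [Polynomial.map_sub, hmap, Polynomial.map_C, Polynomial.map_prod] at hdvd'
  have hX : ∏ i : k × k, (Polynomial.X - Polynomial.C (a i)).map (Polynomial.evalRingHom (0 : R)) =
      Polynomial.X ^ Fintype.card k ^ 2 := by
    simp [a, sq]
  rw [hX, Polynomial.X_pow_dvd_iff] at hdvd'
  simpa [Polynomial.coeff_C, hd.ne'] using hdvd' d hdq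

end Direction

section Invariants

variable [Fintype k] {m : ℕ}

/-- The symplectic pairing of the generic vector with its image under the `n`-th power of the
Frobenius. -/
noncomputable def symplecticForm (m : ℕ) (k : Type) [Field k] [Fintype k] (n : ℕ) :
    MvPolynomial (Fin m ⊕ Fin m) k :=
  ∑ j, (X (.inl j) * X (.inr j) ^ Fintype.card k ^ n -
    X (.inl j) ^ Fintype.card k ^ n * X (.inr j))

lemma symplecticForm_eq_dotProduct (n : ℕ) :
    symplecticForm m k n =
      -(X ⬝ᵥ Matrix.J (Fin m) (MvPolynomial (Fin m ⊕ Fin m) k) *ᵥ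
        fun i => X i ^ Fintype.card k ^ n) := by
  simp only [symplecticForm, dotProduct, Matrix.J, Fintype.sum_sum_type, Matrix.mulVec,
    Matrix.fromBlocks_apply₁₁, Matrix.fromBlocks_apply₁₂, Matrix.fromBlocks_apply₂₁,
    Matrix.fromBlocks_apply₂₂, Matrix.neg_apply, Matrix.one_apply, Matrix.zero_apply]
  simp [Finset.sum_sub_distrib, mul_comm]
  ring

lemma symplecticForm_mem_invariantRing (n : ℕ) :
    symplecticForm m k n ∈ invariantRing (SpSet m k) := by
  rw [mem_invariantRing_SpSet]
  intro g hg
  set G := g.map (C (σ := Fin m ⊕ Fin m)) with hG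
  have hX : (fun i => polySub g (X i)) = G *ᵥ X := by
    funext i
    simp [hG, polySub_X, Matrix.mulVec, dotProduct]
  have hXn : (fun i => polySub g (X i ^ Fintype.card k ^ n)) =
      G *ᵥ fun i => X i ^ Fintype.card k ^ n := by
    funext i
    rw [map_pow, polySub_X, ← frobeniusPow_apply (k := k), map_sum]
    refine Finset.sum_congr rfl fun j _ => ?_
    rw [map_mul, algHom_C, frobeniusPow_apply, MvPolynomial.algebraMap_eq]
    rfl
  have hGmem := SymplecticGroup.mem_iff'.1
    (SymplecticGroup.map_mem hg (C (R := k) (σ := Fin m ⊕ Fin m)))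
  have hmap : (polySub g) (X ⬝ᵥ Matrix.J (Fin m) (MvPolynomial (Fin m ⊕ Fin m) k) *ᵥ
      fun i => X i ^ Fintype.card k ^ n) = (G *ᵥ X) ⬝ᵥ Matrix.J (Fin m) _ *ᵥ
      (G *ᵥ fun i => X i ^ Fintype.card k ^ n) := by
    rw [← hX, ← hXn]
    simp [Matrix.J, dotProduct, Matrix.mulVec, Matrix.one_apply]
  rw [symplecticForm_eq_dotProduct, map_neg, hmap, neg_inj, Matrix.dotProduct_mulVec,
    Matrix.vecMul_mulVec, ← Matrix.dotProduct_mulVec, Matrix.mulVec_mulVec,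
    hGmem]

/-- The ideal of the polynomial ring generated by the first `m` symplectic forms. -/
noncomputable def symplecticIdeal (m : ℕ) (k : Type) [Field k] [Fintype k] :
    Ideal (MvPolynomial (Fin m ⊕ Fin m) k) :=
  Ideal.span (Set.range fun i : Fin m => symplecticForm m k (i + 1))

lemma polySub_mem_symplecticIdeal {g : Matrix (Fin m ⊕ Fin m) (Fin m ⊕ Fin m) k}
    (hg : g ∈ symplecticGroup (Fin m) k) {f : MvPolynomial (Fin m ⊕ Fin m) k}
    (hf : f ∈ symplecticIdeal m k) : polySub g f ∈ symplecticIdeal m k := by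
  suffices H : symplecticIdeal m k ≤ (symplecticIdeal m k).comap (polySub g) from H hf
  refine Ideal.span_le.2 ?_
  rintro _ ⟨i, rfl⟩
  rw [SetLike.mem_coe, Ideal.mem_comap,
    mem_invariantRing_SpSet.1 (symplecticForm_mem_invariantRing _) g hg]
  exact Ideal.subset_span ⟨i, rfl⟩

/-- By Cramer's rule, a multiplier that does not vanish on the standard Lagrangian subspace takes
the next symplectic form into `symplecticIdeal`. -/
lemma exists_mul_symplecticForm_mem (m : ℕ) (k : Type) [Field k] [Fintype k] (n : ℕ) :
    ∃ h, restrictLagrangian m k h ≠ 0 ∧ h * symplecticForm m k (n + 1) ∈ symplecticIdeal m k := by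
  have hq : 1 < Fintype.card k := Fintype.one_lt_card
  let N : ℕ → Fin m → MvPolynomial (Fin m ⊕ Fin m) k := fun i j =>
    X (.inr j) ^ Fintype.card k ^ (i + 1) -
      X (.inl j) ^ (Fintype.card k ^ (i + 1) - 1) * X (.inr j)
  have hN (i : ℕ) : symplecticForm m k (i + 1) = ∑ j, N i j * X (.inl j) := by
    refine Finset.sum_congr rfl fun j _ => ?_
    have hpos : Fintype.card k ^ (i + 1) ≠ 0 := by positivity
    rw [← pow_sub_one_mul hpos (X (Sum.inl j))]
    ring
  let M : Matrix (Fin m) (Fin m) (MvPolynomial (Fin m ⊕ Fin m) k) := Matrix.of fun i j => N i j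
  have hM (j : Fin m) : M.det * X (.inl j) ∈ symplecticIdeal m k := by
    have h1 : M *ᵥ (fun j => X (.inl j)) = fun i : Fin m => symplecticForm m k (i + 1) := by
      funext i
      rw [hN]
      rfl
    have h2 : M.det * X (.inl j) =
        ∑ i, M.adjugate j i * symplecticForm m k (i + 1) := by
      have := congrFun (congrArg (M.adjugate *ᵥ ·) h1) j
      rw [Matrix.mulVec_mulVec, Matrix.adjugate_mul, Matrix.smul_mulVec, Matrix.one_mulVec] at this
      exact this
    rw [h2]
    exact Ideal.sum_mem _ fun i _ => Ideal.mul_mem_left _ _ (Ideal.subset_span ⟨i, rfl⟩)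
  refine ⟨M.det, fun hdet => ?_, ?_⟩
  · rw [AlgHom.map_det, ← Matrix.exists_vecMul_eq_zero_iff] at hdet
    obtain ⟨v, hv, hv0⟩ := hdet
    refine hv (funext fun i => ?_)
    have := eq_zero_of_sum_mul_X_pow_eq_zero 1 (fun i => if h : i < m then v ⟨i, h⟩ else 0)
      (fun j => ?_) i i.2
    · simpa using this
    · rw [Finset.sum_range]
      have hj := congrFun hv0 j
      have hne (i : ℕ) : Fintype.card k ^ (i + 1) - 1 ≠ 0 := by
        have := Nat.one_lt_pow (n := i + 1) (by omega) hq
        omega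
      simpa [Matrix.vecMul, dotProduct, M, N, restrictLagrangian, hne, add_comm 1] using hj
  · rw [hN, Finset.mul_sum]
    refine Ideal.sum_mem _ fun j _ => ?_
    rw [mul_left_comm]
    exact Ideal.mul_mem_left _ _ (hM j)

/-- The multiplier can be chosen to be invariant under the symplectic group. -/
lemma exists_invariant_mul_symplecticForm_mem (m : ℕ) (k : Type) [Field k] [Fintype k] (n : ℕ) :
    ∃ h ∈ invariantRing (SpSet m k), restrictLagrangian m k h ≠ 0 ∧
      h * symplecticForm m k (n + 1) ∈ symplecticIdeal m k := by
  classical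
  obtain ⟨h₀, hne, hmem⟩ := exists_mul_symplecticForm_mem m k n
  let Q : Ideal (MvPolynomial (Fin m ⊕ Fin m) k) :=
    Submodule.comap (LinearMap.mulRight _ (symplecticForm m k (n + 1))) (symplecticIdeal m k)
  have hQ {f} : f ∈ Q ↔ f * symplecticForm m k (n + 1) ∈ symplecticIdeal m k := Iff.rfl
  let P : symplecticGroup (Fin m) k → Ideal (MvPolynomial (Fin m ⊕ Fin m) k) := fun g =>
    RingHom.ker ((restrictLagrangian m k).comp (polySub g.1))
  have : Fintype (symplecticGroup (Fin m) k) := Fintype.ofFinite _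
  obtain ⟨f, hf, hfP⟩ : ∃ f ∈ Q, ∀ g, f ∉ P g := by
    by_contra! hcon
    obtain ⟨g, -, hg⟩ := (Ideal.subset_union_prime (s := Finset.univ) (f := P) 1 1
      fun g _ _ _ => RingHom.ker_isPrime _).1 fun f hf => by simpa using hcon f hf
    have hgQ : polySub (g⁻¹ : symplecticGroup (Fin m) k).1 h₀ ∈ Q := by
      have := polySub_mem_symplecticIdeal (g⁻¹).2 hmem
      rwa [map_mul, mem_invariantRing_SpSet.1 (symplecticForm_mem_invariantRing _) _ (g⁻¹).2]
        at this
    have := hg hgQ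
    rw [RingHom.mem_ker, AlgHom.comp_apply, polySub_polySub, ← Submonoid.coe_mul,
      inv_mul_cancel, Submonoid.coe_one, polySub_one] at this
    exact hne this
  refine ⟨∏ g : symplecticGroup (Fin m) k, polySub g.1 f, ?_, ?_, ?_⟩
  · rw [mem_invariantRing_SpSet]
    intro g hg
    simp only [map_prod, polySub_polySub]
    exact Equiv.prod_comp (Equiv.mulRight (⟨g, hg⟩ : symplecticGroup (Fin m) k))
      fun x : symplecticGroup (Fin m) k => polySub x.1 f
  · rw [map_prod]
    exact Finset.prod_ne_zero_iff.2 fun g _ => hfP g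
  · rw [← hQ, ← Finset.mul_prod_erase _ _ (Finset.mem_univ 1)]
    refine Ideal.mul_mem_right _ _ ?_
    rwa [Submonoid.coe_one, polySub_one]

/-- Comparison of the terms of degree one transversally to the standard Lagrangian subspace. -/
lemma restrictLagrangian_mul_X_pow_eq_sum {n : ℕ} {h : MvPolynomial (Fin m ⊕ Fin m) k}
    {s : Finset ℕ} {a : ℕ → MvPolynomial (Fin m ⊕ Fin m) k}
    (hrel : h * symplecticForm m k (n + 1) = ∑ i ∈ s, a i * symplecticForm m k (i + 1))
    (j : Fin m) :
    restrictLagrangian m k h * X j ^ Fintype.card k ^ (n + 1) =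
      ∑ i ∈ s, restrictLagrangian m k (a i) * X j ^ Fintype.card k ^ (i + 1) := by
  let Ψ : MvPolynomial (Fin m ⊕ Fin m) k →ₐ[k] Polynomial (MvPolynomial (Fin m) k) :=
    aeval (Sum.elim (fun i => if i = j then Polynomial.X else 0) fun i => Polynomial.C (X i))
  have hΨ (f : MvPolynomial (Fin m ⊕ Fin m) k) : (Ψ f).coeff 0 = restrictLagrangian m k f := by
    rw [Polynomial.coeff_zero_eq_eval_zero]
    suffices H : ((Polynomial.aeval (0 : MvPolynomial (Fin m) k)).restrictScalars k).comp Ψ =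
        restrictLagrangian m k from by simpa using DFunLike.congr_fun H f
    refine MvPolynomial.algHom_ext fun i => ?_
    rcases i with i | i
    · by_cases hij : i = j <;> simp [Ψ, restrictLagrangian, hij]
    · simp [Ψ, restrictLagrangian]
  have hq : 1 < Fintype.card k := Fintype.one_lt_card
  have hcoeff (f : MvPolynomial (Fin m ⊕ Fin m) k) (i : ℕ) :
      (Ψ (f * symplecticForm m k (i + 1))).coeff 1 =
        restrictLagrangian m k f * X j ^ Fintype.card k ^ (i + 1) := by
    have h1 := Nat.one_lt_pow (n := i + 1) (by omega) hq
    have hform : Ψ (symplecticForm m k (i + 1)) = Polynomial.X *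
        Polynomial.C (X j ^ Fintype.card k ^ (i + 1)) -
          Polynomial.X ^ Fintype.card k ^ (i + 1) * Polynomial.C (X j) := by
      simp [symplecticForm, Ψ, ite_pow, ite_mul, Finset.sum_sub_distrib]
    rw [map_mul, hform, mul_sub, Polynomial.coeff_sub, ← mul_assoc, ← mul_assoc,
      Polynomial.coeff_mul_C, Polynomial.coeff_mul_C, Polynomial.coeff_mul_X_pow',
      if_neg (by omega), zero_mul, sub_zero, Polynomial.coeff_mul_X, hΨ]
  have := congrArg (fun f => (Ψ f).coeff 1) hrel
  simpa only [map_sum, Polynomial.finsetSum_coeff, hcoeff] using this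

/-- A multiple of the symplectic form of index `m + 1` by an invariant that does not vanish on the
standard Lagrangian subspace is no combination of the previous forms with invariant
coefficients. -/
lemma restrictLagrangian_eq_zero_of_mul_eq_sum (hm : 2 ≤ m)
    {h : MvPolynomial (Fin m ⊕ Fin m) k} {a : ℕ → MvPolynomial (Fin m ⊕ Fin m) k}
    (hh : h ∈ invariantRing (SpSet m k)) (ha : ∀ i, a i ∈ invariantRing (SpSet m k))
    (hrel : h * symplecticForm m k (m + 1) =
      ∑ i ∈ Finset.range m, a i * symplecticForm m k (i + 1)) :
    restrictLagrangian m k h = 0 := by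
  have hq : 1 < Fintype.card k := Fintype.one_lt_card
  obtain ⟨ν, hν⟩ := exists_forall_sq_sub_self_add_ne_zero k
  let K := AlgebraicClosure k
  obtain ⟨s, hs⟩ : ∃ s : K, s ^ 2 - s + algebraMap k K ν = 0 := by
    have hdeg : (Polynomial.X ^ 2 - Polynomial.X + Polynomial.C (algebraMap k K ν)).degree = 2 := by
      compute_degree!
    obtain ⟨s, hs⟩ := IsAlgClosed.exists_root _ (hdeg.trans_ne (by norm_num))
    exact ⟨s, by simpa using hs⟩
  obtain ⟨n, rfl⟩ : ∃ n, m = n + 2 := ⟨m - 2, by omega⟩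
  have hi : (0 : Fin (n + 2)) ≠ 1 := by simp
  set u : Fin (n + 2) → K := Pi.single 0 (s - 1) + Pi.single 1 1 with hu
  have hrel' := restrictLagrangian_mul_X_pow_eq_sum hrel
  have hvanish {f} (hf : f ∈ invariantRing (SpSet (n + 2) k)) :
      (taylorAlong u (restrictLagrangian (n + 2) k f)).coeff (Fintype.card k) = 0 :=
    coeff_taylorAlong_restrictLagrangian hν hs hi hf (by omega) (by nlinarith)
  have hcoeff {f} (hf : f ∈ invariantRing (SpSet (n + 2) k)) (i : ℕ) :
      (taylorAlong u (restrictLagrangian (n + 2) k f * X 1 ^ Fintype.card k ^ (i + 1))).coeff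
        (Fintype.card k) =
      if i = 0 then MvPolynomial.map (algebraMap k K) (restrictLagrangian (n + 2) k f) else 0 := by
    have hX : taylorAlong u (X 1 : MvPolynomial (Fin (n + 2)) k) =
        Polynomial.C (X 1) + Polynomial.X := by
      simp [taylorAlong, hu]
    rw [map_mul, map_pow, hX, ← frobeniusPow_apply (k := k), map_add, frobeniusPow_apply,
      frobeniusPow_apply, mul_add, Polynomial.coeff_add, ← Polynomial.C_pow,
      Polynomial.coeff_mul_C, hvanish hf, zero_mul, zero_add, Polynomial.coeff_mul_X_pow']
    rcases Nat.eq_zero_or_pos i with rfl | hpos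
    · simp [coeff_zero_taylorAlong]
    · rw [if_neg, if_neg hpos.ne']
      simpa using Nat.pow_lt_pow_right hq (show 1 < i + 1 by omega)
  have ha0 : restrictLagrangian (n + 2) k (a 0) = 0 := by
    have := congrArg (fun f => (taylorAlong u f).coeff (Fintype.card k)) (hrel' 1)
    simp only [map_sum, Polynomial.finsetSum_coeff, hcoeff hh, hcoeff (ha _)] at this
    refine MvPolynomial.map_injective _ (algebraMap k K).injective ?_
    simpa using this.symm
  have := eq_zero_of_sum_mul_X_pow_eq_zero 2
    (fun i => if i = n + 1 then -restrictLagrangian (n + 2) k h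
      else restrictLagrangian (n + 2) k (a (i + 1))) (fun j => ?_) (n + 1) (by omega)
  · simpa using this
  · have hj := hrel' j
    rw [Finset.sum_range_succ', ha0, zero_mul, add_zero] at hj
    rw [Finset.sum_range_succ, if_pos rfl, neg_mul, ← sub_eq_add_neg, sub_eq_zero]
    have hexp : 2 + (n + 1) = n + 2 + 1 := by omega
    rw [hexp, hj]
    refine Finset.sum_congr rfl fun i hi => ?_
    rw [if_neg (Finset.mem_range.1 hi).ne, show 2 + i = i + 1 + 1 by omega]

end Invariants

/-- A graded surjective linear map onto the invariant ring takes `1` to a nonzero constant. -/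
lemma exists_apply_one_eq_C {S : Set (Matrix ι ι k)}
    {π : MvPolynomial ι k →ₗ[invariantRing S] invariantRing S} (hπ : Function.Surjective π)
    (hgr : ∀ (d : ℕ) (f : MvPolynomial ι k),
      f.IsHomogeneous d → (π f : MvPolynomial ι k).IsHomogeneous d) :
    ∃ c : k, c ≠ 0 ∧ (π 1 : MvPolynomial ι k) = C c := by
  have h1 : (π 1 : MvPolynomial ι k) = C (coeff 0 (π 1 : MvPolynomial ι k)) := by
    rw [← totalDegree_eq_zero_iff_eq_C, totalDegree_zero_iff_isHomogeneous]
    exact hgr 0 1 (isHomogeneous_one _ _)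
  refine ⟨_, fun h0 => ?_, h1⟩
  rw [h0, C_0] at h1
  obtain ⟨f, hf⟩ := hπ 1
  have hd (d : ℕ) : coeff 0 (π (homogeneousComponent d f) : MvPolynomial ι k) = 0 := by
    rcases Nat.eq_zero_or_pos d with rfl | hd
    · have hsmul : homogeneousComponent 0 f =
          algebraMap k (invariantRing S) (coeff 0 f) • (1 : MvPolynomial ι k) := by
        rw [homogeneousComponent_zero, Algebra.smul_def, mul_one]
        rfl
      rw [hsmul, map_smul, smul_eq_mul, MulMemClass.coe_mul, h1, mul_zero, coeff_zero]
    · by_contra hne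
      have := hgr d _ (homogeneousComponent_isHomogeneous d f) hne
      simp at this
      omega
  have hsum := congrArg (fun f => coeff 0 (π f : MvPolynomial ι k)) (sum_homogeneousComponent f)
  simp only [map_sum, AddSubmonoidClass.coe_finsetSum, coeff_sum, hd, Finset.sum_const_zero,
    hf] at hsum
  simp at hsum

/-- The natural action of `Sp_{2m}(q)`, `m ≥ 2`, on `V = F_q^{2m}` does not
have the direct summand property. -/
theorem Sp_not_directSummand
    (p r : ℕ) [Fact p.Prime] (hr : 0 < r) (q : ℕ) (hq : q = p ^ r)
    (m : ℕ) (hm : 2 ≤ m)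
    (k : Type) [Field k] [Fintype k] (hk : Fintype.card k = q) :
    ¬ DirectSummand (SpSet m k) := by
  rintro ⟨π, hπ, hgr⟩
  obtain ⟨c, hc, h1⟩ := exists_apply_one_eq_C hπ hgr
  obtain ⟨h, hh, hne, hmem⟩ := exists_invariant_mul_symplecticForm_mem m k m
  obtain ⟨b, hb⟩ := (Ideal.mem_span_range_iff_exists_fun).1 hmem
  let ξ : ℕ → invariantRing (SpSet m k) := fun n =>
    ⟨symplecticForm m k n, symplecticForm_mem_invariantRing n⟩
  let a : ℕ → invariantRing (SpSet m k) := fun i => if hi : i < m then π (b ⟨i, hi⟩) else 0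
  have hrel : (π 1 * ⟨h, hh⟩) * ξ (m + 1) = ∑ i ∈ Finset.range m, a i * ξ (i + 1) := by
    have hb' : (∑ i : Fin m, ξ (i + 1) • b i) = ((⟨h, hh⟩ : invariantRing (SpSet m k)) *
        ξ (m + 1)) • (1 : MvPolynomial (Fin m ⊕ Fin m) k) := by
      simp only [Subalgebra.smul_def, ξ, smul_eq_mul, MulMemClass.coe_mul, mul_one, ← hb,
        mul_comm (symplecticForm _ _ _)]
    have := congrArg π hb'
    rw [map_smul, map_sum] at this
    simp only [map_smul, smul_eq_mul] at this
    rw [Finset.sum_range, mul_assoc, mul_comm, ← this]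
    exact Finset.sum_congr rfl fun i _ => by simp [a, mul_comm]
  have hzero := restrictLagrangian_eq_zero_of_mul_eq_sum hm (π 1 * ⟨h, hh⟩).2
    (fun i => (a i).2) (by simpa [ξ] using congrArg Subtype.val hrel)
  rw [MulMemClass.coe_mul, h1, map_mul, algHom_C] at hzero
  simp [hc, hne] at hzero
end

section
/- Let k = F_{q²}, n ≥ 4, and equip V = k^n with a nondegenerate hermitian form (with respect to the involution x ↦ x^q), with unitary group GU_n(q) and special unitary group SU_n(q). Let G be any group with SU_n(q) ≤ G ≤ GU_n(q). Then the action of G on V does not have the direct summand property. -/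
open MvPolynomial Matrix

set_option synthInstance.maxHeartbeats 1000000
set_option maxHeartbeats 1000000

variable {k : Type} [Field k] {ι : Type} [Fintype ι] [DecidableEq ι]

/-- The unitary group `GU_n(q)` of a hermitian Gram matrix `J` over
`k = F_{q²}`: matrices `g` with `gᵀ J ḡ = J`, where `ḡ` is the entrywise
`q`-th power of `g`. -/
def GUSet (n q : ℕ) (k : Type) [Field k] (J : Matrix (Fin n) (Fin n) k) :
    Set (Matrix (Fin n) (Fin n) k) :=
  {g | IsUnit g ∧ g.transpose * J * g.map (fun x => x ^ q) = J}

/-- The special unitary group `SU_n(q)`: the elements of `GU_n(q)` of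
determinant one. -/
def SUSet (n q : ℕ) (k : Type) [Field k] (J : Matrix (Fin n) (Fin n) k) :
    Set (Matrix (Fin n) (Fin n) k) :=
  {g | g ∈ GUSet n q k J ∧ g.det = 1}


section Hermitian

variable {V : Type*} [AddCommGroup V] [Module k V] [FiniteDimensional k V]
  {σ : k →+* k} (B : V →ₗ[k] V →ₛₗ[σ] k)

/-- A subspace of dimension at least two contains a vector orthogonal to a given functional. -/
theorem exists_mem_ne_zero_of_two_le_finrank (M : Submodule k V)
    (hM : 2 ≤ Module.finrank k M) (φ : V →ₗ[k] k) : ∃ w ∈ M, w ≠ 0 ∧ φ w = 0 := by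
  have h := (φ.domRestrict M).finrank_range_add_finrank_ker
  have h2 : Module.finrank k (LinearMap.range (φ.domRestrict M)) ≤ 1 := by
    simpa using Submodule.finrank_le (LinearMap.range (φ.domRestrict M))
  have h3 : LinearMap.ker (φ.domRestrict M) ≠ ⊥ := by
    intro h4
    rw [h4, finrank_bot] at h
    omega
  obtain ⟨w, hw, hw0⟩ := Submodule.exists_mem_ne_zero_of_ne_bot h3
  exact ⟨w, w.2, by simpa using hw0, by simpa using hw⟩

/-- A hermitian form with surjective norm has a nonzero isotropic vector in every subspace of
dimension at least two. -/
theorem exists_isotropic (hB : ∀ v w, B w v = σ (B v w))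
    (hnorm : ∀ a : k, σ a = a → ∃ c, c * σ c = a)
    (M : Submodule k V) (hM : 2 ≤ Module.finrank k M) :
    ∃ v ∈ M, v ≠ 0 ∧ B v v = 0 := by
  obtain ⟨v, hvM, hv0, -⟩ := exists_mem_ne_zero_of_two_le_finrank M hM 0
  by_cases hvv : B v v = 0
  · exact ⟨v, hvM, hv0, hvv⟩
  obtain ⟨w, hwM, hw0, hwv⟩ := exists_mem_ne_zero_of_two_le_finrank M hM (B.flip v)
  replace hwv : B w v = 0 := hwv
  have hvw : B v w = 0 := by rw [hB w v, hwv, map_zero]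
  obtain ⟨c, hc⟩ := hnorm (-(B w w) / B v v) (by
    rw [map_div₀, map_neg, ← hB, ← hB])
  refine ⟨c • v + w, M.add_mem (M.smul_mem c hvM) hwM, fun h => hvv ?_, ?_⟩
  · have h1 : B (c • v + w) v = 0 := by rw [h]; simp
    have h2 : B w (c • v + w) = 0 := by rw [h]; simp
    simp only [map_add, LinearMap.add_apply, map_smul, LinearMap.smul_apply, hwv, smul_eq_mul,
      add_zero, mul_eq_zero, map_smulₛₗ, mul_zero, zero_add] at h1 h2
    rcases h1 with h1 | h1
    · subst h1
      simp only [zero_smul, zero_add] at h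
      exact absurd h hw0
    · exact h1
  · simp only [map_add, LinearMap.add_apply, map_smul, LinearMap.smul_apply, smul_eq_mul,
      map_smulₛₗ, hwv, hvw]
    have : c * (σ c * B v v) = -(B w w) := by
      rw [← mul_assoc, hc]; field_simp
    linear_combination this

/-- Two orthogonal hyperbolic pairs, up to the Gram matrix of the second Lagrangian. -/
theorem exists_hyperbolic_pairs (hσ : ∀ a, σ (σ a) = a) (hB : ∀ v w, B w v = σ (B v w))
    (hnd : ∀ v ≠ 0, ∃ w, B v w ≠ 0)
    (hnorm : ∀ a : k, σ a = a → ∃ c, c * σ c = a) (hV : 4 ≤ Module.finrank k V) :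
    ∃ e f : Fin 2 → V, (∀ i j, B (e i) (e j) = 0) ∧
      ∀ i j, B (e i) (f j) = if i = j then 1 else 0 := by
  have hdual : ∀ v ≠ 0, ∃ w, B v w = 1 := by
    intro v hv
    obtain ⟨w, hw⟩ := hnd v hv
    refine ⟨σ (B v w)⁻¹ • w, ?_⟩
    simp only [map_smulₛₗ, hσ, smul_eq_mul]
    field_simp
  obtain ⟨e₁, -, he₁, h11⟩ := exists_isotropic B hB hnorm ⊤ (by rw [finrank_top]; omega)
  obtain ⟨f₁, hf₁⟩ := hdual e₁ he₁
  obtain ⟨e₂, he₂M, he₂, h22⟩ := exists_isotropic B hB hnorm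
    (LinearMap.ker ((B.flip e₁).prod (B.flip f₁))) (by
      have h := ((B.flip e₁).prod (B.flip f₁)).finrank_range_add_finrank_ker
      have h2 := Submodule.finrank_le (LinearMap.range ((B.flip e₁).prod (B.flip f₁)))
      simp only [Module.finrank_prod, Module.finrank_self] at h2
      omega)
  have h21 : B e₂ e₁ = 0 := (Prod.ext_iff.1 he₂M).1
  have h21' : B e₂ f₁ = 0 := (Prod.ext_iff.1 he₂M).2
  have h12 : B e₁ e₂ = 0 := by rw [hB e₂ e₁, h21, map_zero]
  obtain ⟨f₂, hf₂⟩ := hdual e₂ he₂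
  refine ⟨![e₁, e₂], ![f₁, f₂ - σ (B e₁ f₂) • f₁], ?_, ?_⟩
  · intro i j
    fin_cases i <;> fin_cases j <;> simp [h11, h12, h21, h22]
  · intro i j
    fin_cases i <;> fin_cases j <;> simp [hf₁, hf₂, h21', hσ]

/-- A basis adapted to two hyperbolic pairs. -/
theorem exists_adapted_family (hσ : ∀ a, σ (σ a) = a) (hB : ∀ v w, B w v = σ (B v w))
    (hnd : ∀ v ≠ 0, ∃ w, B v w ≠ 0)
    (hnorm : ∀ a : k, σ a = a → ∃ c, c * σ c = a) (d : ℕ) (hV : Module.finrank k V = d + 4) :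
    ∃ (f e : Fin 2 → V) (u : Fin d → V),
      LinearIndependent k (Sum.elim f (Sum.elim e u)) ∧
      (∀ i j, B (e i) (e j) = 0) ∧ (∀ i j, B (e i) (f j) = if i = j then 1 else 0) ∧
      (∀ i j, B (u j) (e i) = 0) ∧ (∀ i j, B (u j) (f i) = 0) := by
  obtain ⟨e, f, hee, hef⟩ := exists_hyperbolic_pairs B hσ hB hnd hnorm (by omega)
  have hfe : ∀ i j, B (f j) (e i) = if i = j then 1 else 0 := by
    intro i j
    rw [hB (e i) (f j), hef]; split_ifs <;> simp
  let φ : V →ₗ[k] (Fin 2 ⊕ Fin 2 → k) := LinearMap.pi (fun i => B.flip (Sum.elim e f i))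
  have hφ : ∀ v i, φ v i = B v (Sum.elim e f i) := fun v i => rfl
  have hsurj : Function.Surjective φ := by
    intro c
    let w : V := ∑ i, c (Sum.inl i) • f i
    refine ⟨w + ∑ i, (c (Sum.inr i) - B w (f i)) • e i, ?_⟩
    ext i
    rw [hφ]
    rcases i with i | i
    · simp only [w, Sum.elim_inl, map_add, LinearMap.add_apply, map_sum, map_smul,
        LinearMap.sum_apply, LinearMap.smul_apply, hfe, hee]
      simp
    · simp only [Sum.elim_inr, map_add, LinearMap.add_apply, map_sum (B), map_smul,
        LinearMap.sum_apply, LinearMap.smul_apply, hef]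
      simp
  have hker : Module.finrank k (LinearMap.ker φ) = d := by
    have h := φ.finrank_range_add_finrank_ker
    rw [LinearMap.range_eq_top.2 hsurj, finrank_top, hV] at h
    simp at h
    omega
  let b := Module.finBasisOfFinrankEq k (LinearMap.ker φ) hker
  have hb : ∀ j i, B (b j) (Sum.elim e f i) = 0 := fun j i => congr_fun (b j).2 i
  refine ⟨f, e, fun j => b j, ?_, hee, hef, fun i j => hb j (Sum.inl i),
    fun i j => hb j (Sum.inr i)⟩
  rw [Fintype.linearIndependent_iff]
  intro c hc
  simp only [Fintype.sum_sum_type, Sum.elim_inl, Sum.elim_inr] at hc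
  have hx : ∀ i, c (Sum.inl i) = 0 := by
    intro i
    have h := congr_arg (fun v => B v (e i)) hc
    have hb' : ∀ j, B (b j) (e i) = 0 := fun j => hb j (Sum.inl i)
    simpa [hee, hfe, hb', LinearMap.sum_apply, -Fin.sum_univ_two] using h
  have hy : ∀ i, c (Sum.inr (Sum.inl i)) = 0 := by
    intro i
    have h := congr_arg (fun v => B v (f i)) hc
    have hb' : ∀ j, B (b j) (f i) = 0 := fun j => hb j (Sum.inr i)
    simpa [hx, hef, hb', LinearMap.sum_apply, -Fin.sum_univ_two] using h
  have hu : ∀ j, c (Sum.inr (Sum.inr j)) = 0 := by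
    simp only [hx, hy, zero_smul, Finset.sum_const_zero, zero_add] at hc
    refine Fintype.linearIndependent_iff.1 b.linearIndependent _ (Subtype.ext ?_)
    simpa using hc
  rintro (i | i | i)
  exacts [hx i, hy i, hu i]

end Hermitian

/-- A generalized Vandermonde determinant in distinct variables with distinct exponents does not
vanish. -/
theorem det_X_pow_ne_zero {m τ : Type*} [Fintype m] [DecidableEq m] (v : m → τ)
    (hv : Function.Injective v) (e : m → ℕ) (he : Function.Injective e) :
    (Matrix.of fun i j => (X (v i) : MvPolynomial τ k) ^ e j).det ≠ 0 := by
  classical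
  intro h
  have hmon : ∀ s : Equiv.Perm m, (∏ i, (X (v (s i)) : MvPolynomial τ k) ^ e i) =
      monomial (∑ i, Finsupp.single (v (s i)) (e i)) 1 := by
    intro s
    simp only [X_pow_eq_monomial]
    rw [monomial_sum_one]
  have h2 := congr_arg (coeff (∑ i, Finsupp.single (v i) (e i))) h
  rw [Matrix.det_apply, coeff_sum, Finset.sum_eq_single 1] at h2
  · rw [Equiv.Perm.sign_one, one_smul] at h2
    have h3 := hmon 1
    simp only [Equiv.Perm.one_apply] at h3
    simp only [Matrix.of_apply, Equiv.Perm.one_apply, coeff_zero] at h2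
    rw [h3, coeff_monomial, if_pos rfl] at h2
    exact one_ne_zero h2
  · intro s _ hs
    simp only [Matrix.of_apply, hmon, Units.smul_def, coeff_smul, coeff_monomial]
    rw [if_neg, smul_zero]
    intro heq
    apply hs
    ext i
    have h3 := DFunLike.congr_fun heq (v (s i))
    simp only [Finsupp.coe_finsetSum, Finset.sum_apply, Finsupp.single_apply, hv.eq_iff,
      s.injective.eq_iff, Finset.sum_ite_eq', Finset.mem_univ, if_true] at h3
    exact (he h3).symm
  · simp

section Translation

open Polynomial in
/-- A polynomial invariant under all translations by multiples of `ℓ` reduces modulo `ℓ` to a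
polynomial in the power of the variable given by the cardinality of the field. -/
theorem exists_map_eq_expand [Fintype k] {Q Q' : Type*} [CommRing Q] [IsDomain Q] [Algebra k Q]
    [CommRing Q'] (ℓ : Q) (hℓ : ℓ ≠ 0) (ev : Q →+* Q') (hev : ev ℓ = 0) (α : Q[X])
    (hα : ∀ b : k, α.comp (Polynomial.X + Polynomial.C (b • ℓ)) = α) :
    ∃ β : Q'[X], α.map ev = expand Q' (Fintype.card k) β := by
  classical
  induction hn : α.natDegree using Nat.strong_induction_on generalizing α with
  | _ n ih =>
  have hinj : Function.Injective fun b : k => b • ℓ := smul_left_injective k hℓ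
  let N : Q[X] := ∏ b : k, (Polynomial.X - Polynomial.C (b • ℓ))
  have hN : N.Monic := monic_prod_of_monic _ _ fun b _ => monic_X_sub_C _
  have hNdeg : N.natDegree = Fintype.card k := by
    rw [natDegree_prod_of_monic _ _ fun b _ => monic_X_sub_C _]
    simp
  have hNcomp : ∀ b : k, N.comp (Polynomial.X + Polynomial.C (b • ℓ)) = N := by
    intro b
    rw [Polynomial.prod_comp]
    refine Fintype.prod_equiv (Equiv.subRight b) _ _ fun c => ?_
    simp [sub_smul]
    ring
  have hNmap : N.map ev = Polynomial.X ^ Fintype.card k := by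
    have : ∀ b : k, ev (b • ℓ) = 0 := fun b => by
      rw [Algebra.smul_def, map_mul, hev, mul_zero]
    simp [N, Polynomial.map_prod, this]
  by_cases hα0 : α = Polynomial.C (α.eval 0)
  · refine ⟨Polynomial.C (ev (α.eval 0)), ?_⟩
    rw [hα0]; simp
  have hdvd : N ∣ α - Polynomial.C (α.eval 0) := by
    have h := (Multiset.prod_X_sub_C_dvd_iff_le_roots (sub_ne_zero.2 hα0)
      (Finset.univ.val.map fun b : k => b • ℓ)).2 ((Multiset.le_iff_subset
        (Finset.univ.nodup.map hinj)).2 fun r hr => by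
          obtain ⟨b, -, rfl⟩ := Multiset.mem_map.1 hr
          rw [mem_roots (sub_ne_zero.2 hα0), IsRoot.def, Polynomial.eval_sub, Polynomial.eval_C, sub_eq_zero]
          conv_rhs => rw [← hα b]
          simp)
    rw [Multiset.map_map] at h
    exact h
  obtain ⟨γ, hγ⟩ := hdvd
  have hγ0 : γ ≠ 0 := by
    rintro rfl
    exact sub_ne_zero.2 hα0 (by rw [hγ, mul_zero])
  have hγcomp : ∀ b : k, γ.comp (Polynomial.X + Polynomial.C (b • ℓ)) = γ := by
    intro b
    have h := congr_arg (fun r => Polynomial.comp r (Polynomial.X + Polynomial.C (b • ℓ))) hγ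
    simp only [sub_comp, mul_comp, hα, C_comp, hNcomp] at h
    exact mul_left_cancel₀ hN.ne_zero (h.symm.trans hγ)
  have hdeg : γ.natDegree < n := by
    have h := congr_arg natDegree hγ
    rw [natDegree_sub_C, hN.natDegree_mul' hγ0, hNdeg] at h
    have := Fintype.card_pos (α := k)
    omega
  obtain ⟨β, hβ⟩ := ih _ hdeg γ hγcomp rfl
  refine ⟨Polynomial.C (ev (α.eval 0)) + Polynomial.X * β, ?_⟩
  rw [eq_add_of_sub_eq hγ, Polynomial.map_add, Polynomial.map_mul, hNmap, hβ, ← hγ]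
  simp [add_comm]

open Polynomial in
theorem eq_zero_of_expand_add_X_pow {A : Type*} [CommRing A] [IsDomain A] {N m : ℕ} (hm : 0 < m)
    (hmN : m < N) (α γ δ : A[X]) (κ : A) (hκ : κ ≠ 0)
    (h : expand A N γ = expand A N α * (Polynomial.C κ * Polynomial.X ^ m + expand A N δ)) :
    α = 0 := by
  have h1 : expand A N (γ - α * δ) = expand A N (Polynomial.C κ * α) * Polynomial.X ^ m := by
    simp only [map_sub, map_mul, Polynomial.expand_C]
    linear_combination h
  have hN : 0 < N := by omega
  ext i
  have h2 := congr_arg (fun r => Polynomial.coeff r (i * N + m)) h1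
  simp only [coeff_mul_X_pow, coeff_expand_mul hN] at h2
  rw [coeff_expand hN, if_neg] at h2
  · simpa [hκ] using h2.symm
  · rw [Nat.dvd_add_right (Dvd.intro_left i rfl)]
    exact Nat.not_dvd_of_pos_of_lt hm hmN

end Translation

section DirectSummand

theorem mem_invariantRing {S : Set (Matrix ι ι k)} {f : MvPolynomial ι k} :
    f ∈ invariantRing S ↔ ∀ g ∈ S, polyAct g f = f := by
  simp [invariantRing, Algebra.mem_iInf, AlgHom.mem_equalizer]

/-- Under the direct summand property ideals of invariants are contracted. -/
theorem DirectSummand.exists_invariant_coeff {S : Set (Matrix ι ι k)} (hS : DirectSummand S)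
    {f h₀ h₁ : MvPolynomial ι k} (hf : f ∈ invariantRing S) (hh₀ : h₀ ∈ invariantRing S)
    (hh₁ : h₁ ∈ invariantRing S) (hmem : f ∈ Ideal.span {h₀, h₁}) :
    ∃ a ∈ invariantRing S, ∃ b ∈ invariantRing S, f = a * h₀ + b * h₁ := by
  obtain ⟨π, hsurj, hgr⟩ := hS
  obtain ⟨g, hg⟩ := hsurj 1
  have hdeg : ∀ d, (π (homogeneousComponent d g) : MvPolynomial ι k).IsHomogeneous d :=
    fun d => hgr d _ (homogeneousComponent_isHomogeneous d g)
  have hsum : (1 : MvPolynomial ι k) =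
      ∑ d ∈ Finset.range (g.totalDegree + 1), (π (homogeneousComponent d g) : MvPolynomial ι k) := by
    have h := congr_arg (fun r : invariantRing S => (r : MvPolynomial ι k)) hg
    rw [← sum_homogeneousComponent g, map_sum] at h
    simpa using h.symm
  have hone : (π (C (coeff 0 g)) : MvPolynomial ι k) = 1 := by
    have h := congr_arg (homogeneousComponent 0) hsum
    rw [map_sum, Finset.sum_eq_single 0] at h
    · rw [homogeneousComponent_of_mem (hdeg 0), if_pos rfl, homogeneousComponent_zero] at h
      rw [homogeneousComponent_zero] at h
      simpa using h.symm
    · intro d _ hd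
      rw [homogeneousComponent_of_mem (hdeg d), if_neg hd.symm]
    · simp
  obtain ⟨a, b, hab⟩ := Ideal.mem_span_pair.1 hmem
  have key : ∀ (r : invariantRing S) (s : MvPolynomial ι k),
      (π (s * r) : MvPolynomial ι k) = π s * r := by
    intro r s
    have : s * r = r • s := by rw [mul_comm]; rfl
    rw [this, map_smul, smul_eq_mul, mul_comm]; rfl
  have hc := key ⟨f, hf⟩ (C (coeff 0 g))
  refine ⟨_, (π (C (coeff 0 g) * a)).2, _, (π (C (coeff 0 g) * b)).2, ?_⟩
  rw [← key ⟨h₀, hh₀⟩, ← key ⟨h₁, hh₁⟩, ← Subalgebra.coe_add, ← map_add]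
  rw [hone, one_mul] at hc
  have hfc : C (coeff 0 g) * f = C (coeff 0 g) * a * h₀ + C (coeff 0 g) * b * h₁ := by
    rw [← hab]; ring
  exact hc.symm.trans (by simp only [hfc])

end DirectSummand

section LinearSubstitution

variable {κ μ : Type} [Fintype μ]

/-- Substitution of the variables by the linear forms given by the rows of a matrix. -/
noncomputable def linSub (M : Matrix κ μ k) : MvPolynomial κ k →ₐ[k] MvPolynomial μ k :=
  aeval fun i => ∑ j, C (M i j) * X j

theorem linSub_X (M : Matrix κ μ k) (i : κ) : linSub M (X i) = ∑ j, C (M i j) * X j :=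
  aeval_X _ _

theorem linSub_linSub {ν : Type} [Fintype ν] (M : Matrix κ μ k) (N : Matrix μ ν k)
    (f : MvPolynomial κ k) : linSub N (linSub M f) = linSub (M * N) f := by
  suffices h : (linSub N).comp (linSub M) = linSub (M * N) from DFunLike.congr_fun h f
  refine algHom_ext fun i => ?_
  simp only [AlgHom.comp_apply, linSub_X, map_sum, map_mul, algHom_C, algebraMap_eq,
    Matrix.mul_apply, Finset.mul_sum, Finset.sum_mul]
  rw [Finset.sum_comm]
  simp only [mul_assoc]

theorem linSub_one [Fintype κ] [DecidableEq κ] (f : MvPolynomial κ k) :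
    linSub (1 : Matrix κ κ k) f = f := by
  suffices h : linSub (1 : Matrix κ κ k) = AlgHom.id k _ from DFunLike.congr_fun h f
  refine algHom_ext fun i => ?_
  simp [linSub_X, Matrix.one_apply]

/-- The value of a sesquilinear form on two Frobenius twists of the generic vector. -/
noncomputable def gramEntry (q : ℕ) [Fintype κ] (J : Matrix κ κ k) (a b : ℕ) : MvPolynomial κ k :=
  ∑ i, ∑ j, C (J i j) * X i ^ q ^ (2 * a) * X j ^ q ^ (2 * b + 1)

/-- The minors of the Gram matrix of the Frobenius twists of the generic vector. -/
noncomputable def gramMinor (q : ℕ) [Fintype κ] (J : Matrix κ κ k) (d s : ℕ) : MvPolynomial κ k :=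
  (Matrix.of fun i j : Fin (d + 1) => gramEntry q J i (s + j)).det

theorem linSub_X_pow {p : ℕ} [Fact p.Prime] [CharP k p] (m : ℕ) (M : Matrix κ μ k) (i : κ) :
    linSub M (X i) ^ p ^ m = ∑ j, C (M i j ^ p ^ m) * X j ^ p ^ m := by
  rw [linSub_X, sum_pow_char_pow]
  simp [mul_pow]

theorem linSub_gramEntry [Fintype κ] {p r q : ℕ} [Fact p.Prime] [CharP k p] (hq : q = p ^ r)
    (hk : ∀ x : k, x ^ q ^ 2 = x) (J : Matrix κ κ k) (M : Matrix κ μ k) (a b : ℕ) :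
    linSub M (gramEntry q J a b) = gramEntry q (Mᵀ * J * M.map (fun x => x ^ q)) a b := by
  have hk2 : ∀ (x : k) (a : ℕ), x ^ q ^ (2 * a) = x := by
    intro x a
    induction a with
    | zero => simp
    | succ a ih => rw [mul_add, pow_add, pow_mul, ih, mul_one, hk]
  have h1 : ∀ i, linSub M (X i) ^ q ^ (2 * a) = ∑ j, C (M i j) * X j ^ q ^ (2 * a) := by
    intro i
    have := linSub_X_pow (p := p) (r * (2 * a)) M i
    rw [pow_mul, ← hq] at this
    simpa only [hk2] using this
  have h2 : ∀ i, linSub M (X i) ^ q ^ (2 * b + 1) =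
      ∑ j, C (M i j ^ q) * X j ^ q ^ (2 * b + 1) := by
    intro i
    have := linSub_X_pow (p := p) (r * (2 * b + 1)) M i
    rw [pow_mul, ← hq] at this
    simpa only [pow_succ q, pow_mul _ (q ^ (2 * b)) q, hk2] using this
  have hrot : ∀ f : κ → μ → μ → MvPolynomial μ k,
      ∑ i, ∑ l, ∑ m, f i l m = ∑ l, ∑ m, ∑ i, f i l m := by
    intro f
    rw [Finset.sum_comm]
    exact Finset.sum_congr rfl fun l _ => Finset.sum_comm
  have hexp : ∀ i j, C (J i j) * (∑ l, C (M i l) * X l ^ q ^ (2 * a)) *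
      (∑ m, C (M j m ^ q) * X m ^ q ^ (2 * b + 1)) =
      ∑ l, ∑ m, C (M i l * J i j * M j m ^ q) * X l ^ q ^ (2 * a) *
        (X m : MvPolynomial μ k) ^ q ^ (2 * b + 1) := by
    intro i j
    rw [mul_assoc, Finset.sum_mul_sum, Finset.mul_sum]
    refine Finset.sum_congr rfl fun l _ => ?_
    rw [Finset.mul_sum]
    refine Finset.sum_congr rfl fun m _ => ?_
    simp only [map_mul]
    ring
  simp only [gramEntry, map_sum, map_mul, map_pow, algHom_C, algebraMap_eq, h1, h2]
  simp only [← map_pow, hexp, hrot]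
  refine Finset.sum_congr rfl fun l _ => Finset.sum_congr rfl fun m _ => ?_
  rw [Finset.sum_comm]
  simp only [Matrix.mul_apply, Matrix.transpose_apply, Matrix.map_apply, map_sum,
    Finset.sum_mul]

theorem linSub_gramMinor [Fintype κ] {p r q : ℕ} [Fact p.Prime] [CharP k p] (hq : q = p ^ r)
    (hk : ∀ x : k, x ^ q ^ 2 = x) (J : Matrix κ κ k) (M : Matrix κ μ k) (d s : ℕ) :
    linSub M (gramMinor q J d s) = gramMinor q (Mᵀ * J * M.map (fun x => x ^ q)) d s := by
  rw [gramMinor, AlgHom.map_det]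
  simp only [AlgHom.mapMatrix_apply, gramMinor]
  congr 1
  ext1 i j
  exact linSub_gramEntry hq hk J M _ _

end LinearSubstitution

section FirstOrder

variable {d : ℕ} {A : Type*} [CommRing A] [Algebra k A]

/-- The determinant of the odd Frobenius twists of `d + 1` elements. -/
def mooreDet {A : Type*} [CommRing A] {d : ℕ} (q s : ℕ) (y : A) (u : Fin d → A) : A :=
  (Matrix.of fun i j : Fin (d + 1) => (Fin.cons y u : Fin (d + 1) → A) i ^ q ^ (2 * (s + j) + 1)).det

/-- The evaluation with values in the dual numbers which is of first order in the `l`-th of the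
first two variables and kills the other one. -/
noncomputable def firstOrder (y : Fin 2 → A) (u : Fin d → A) (l : Fin 2) :
    MvPolynomial (Fin 2 ⊕ (Fin 2 ⊕ Fin d)) k →ₐ[k] DualNumber A :=
  aeval (Sum.elim (fun i => if i = l then DualNumber.eps else 0)
    (Sum.elim (fun i => TrivSqZeroExt.inl (y i)) (fun i => TrivSqZeroExt.inl (u i))))

theorem firstOrder_gramMinor {q : ℕ} (hq : 2 ≤ q) (y : Fin 2 → A) (u : Fin d → A) (l : Fin 2)
    (F : Matrix (Fin 2) (Fin 2) k) (U : Matrix (Fin d) (Fin d) k) (s : ℕ) :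
    firstOrder y u l (gramMinor q (Matrix.fromBlocks F (Matrix.fromCols 1 0)
      (Matrix.fromRows 1 0) (Matrix.fromBlocks 0 0 0 U)) d s) =
    TrivSqZeroExt.inr ((Matrix.of fun a m : Fin d => u m ^ q ^ (2 * (a.val + 1))).det *
      algebraMap k A U.det * mooreDet q s (y l) u) := by
  have hpow : ∀ N, 2 ≤ N → (DualNumber.eps : DualNumber A) ^ N = 0 := by
    intro N hN
    obtain ⟨c, rfl⟩ := Nat.exists_eq_add_of_le hN
    rw [pow_add, pow_two, DualNumber.eps_mul_eps, zero_mul]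
  have hpow' : ∀ i N, 2 ≤ N → (if i = l then DualNumber.eps else 0 : DualNumber A) ^ N = 0 := by
    intro i N hN
    split_ifs
    · exact hpow N hN
    · exact zero_pow (by omega)
  have hodd : ∀ b, 2 ≤ q ^ (2 * b + 1) := fun b =>
    hq.trans (Nat.le_self_pow (by omega) q)
  have heven : ∀ a, a ≠ 0 → 2 ≤ q ^ (2 * a) := fun a ha =>
    hq.trans (Nat.le_self_pow (by omega) q)
  let L : Matrix (Fin (d + 1)) (Fin (d + 1)) (DualNumber A) := Matrix.of fun i =>
    (Fin.cons (if i = 0 then DualNumber.eps else 0) fun j =>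
      TrivSqZeroExt.inl (∑ m, u m ^ q ^ (2 * i.val) * algebraMap k A (U m j)) :
      Fin (d + 1) → DualNumber A)
  let R : Matrix (Fin (d + 1)) (Fin (d + 1)) A := Matrix.of fun i j =>
    (Fin.cons (y l) u : Fin (d + 1) → A) i ^ q ^ (2 * (s + j) + 1)
  have hentry : (AlgHom.mapMatrix (firstOrder y u l)) (Matrix.of fun i j : Fin (d + 1) =>
      gramEntry q (Matrix.fromBlocks F (Matrix.fromCols 1 0)
      (Matrix.fromRows 1 0) (Matrix.fromBlocks 0 0 0 U)) i (s + j)) =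
      L * (TrivSqZeroExt.inlHom A A).mapMatrix R := by
    ext1 i j
    rw [Matrix.mul_apply, Fin.sum_univ_succ]
    simp only [AlgHom.mapMatrix_apply, Matrix.map_apply, Matrix.of_apply, gramEntry,
      Fintype.sum_sum_type, map_add, map_sum, map_mul, map_pow, firstOrder, aeval_X,
      Sum.elim_inl, Sum.elim_inr, Matrix.fromBlocks_apply₁₁, Matrix.fromBlocks_apply₁₂,
      Matrix.fromBlocks_apply₂₁, Matrix.fromBlocks_apply₂₂, Matrix.fromCols_apply_inl,
      Matrix.fromCols_apply_inr, Matrix.fromRows_apply_inl, Matrix.fromRows_apply_inr,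
      Matrix.zero_apply, map_zero, zero_mul, hpow' _ _ (hodd _), mul_zero,
      Finset.sum_const_zero, add_zero, zero_add, L, R, Fin.cons_zero, Fin.cons_succ,
      RingHom.mapMatrix_apply, TrivSqZeroExt.inlHom_apply]
    have hC : ∀ a : k, algebraMap k (DualNumber A) a = TrivSqZeroExt.inl (algebraMap k A a) :=
      fun a => rfl
    have hsum : ∀ f : Fin d → A, (TrivSqZeroExt.inl (∑ m, f m) : DualNumber A) =
        ∑ m, TrivSqZeroExt.inl (f m) := fun f => map_sum (TrivSqZeroExt.inlHom A A) _ _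
    simp only [algHom_C, hC, hsum, Finset.sum_mul]
    congr 1
    · rw [Finset.sum_eq_single l, Finset.sum_eq_single l]
      · rcases eq_or_ne i 0 with rfl | hi
        · simp
        · rw [hpow' _ _ (heven _ (Fin.val_ne_zero_iff.mpr hi))]
          simp [hi]
      · intro m _ hm
        simp [Matrix.one_apply_ne hm.symm]
      · simp
      · intro m _ hm
        have : 0 < q := by omega
        simp [hm, this.ne']
      · simp
    · rw [Finset.sum_comm]
      refine Finset.sum_congr rfl fun x _ => Finset.sum_congr rfl fun m _ => ?_
      rw [mul_comm (TrivSqZeroExt.inl (algebraMap k A (U m x))), TrivSqZeroExt.inl_mul,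
        TrivSqZeroExt.inl_pow]
  rw [gramMinor, AlgHom.map_det, hentry, Matrix.det_mul, ← RingHom.map_det]
  have hL : L.det = TrivSqZeroExt.inr ((Matrix.of fun a m : Fin d =>
      u m ^ q ^ (2 * (a.val + 1))).det * algebraMap k A U.det) := by
    rw [Matrix.det_succ_column_zero, Finset.sum_eq_single 0]
    · have : L.submatrix (Fin.succAbove 0) Fin.succ = (TrivSqZeroExt.inlHom A A).mapMatrix
          ((Matrix.of fun a m : Fin d => u m ^ q ^ (2 * (a.val + 1))) *
            (algebraMap k A).mapMatrix U) := by
        ext1 i j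
        rw [RingHom.mapMatrix_apply, Matrix.map_apply, Matrix.mul_apply]
        rfl
      rw [this, ← RingHom.map_det, Matrix.det_mul, ← RingHom.map_det]
      simp only [L, Matrix.of_apply, Fin.val_zero, pow_zero, one_mul, Fin.cons_zero, if_true,
        TrivSqZeroExt.inlHom_apply, DualNumber.eps, TrivSqZeroExt.inr_mul_inl,
        MulOpposite.smul_eq_mul_unop, MulOpposite.unop_op]
    · intro i _ hi
      simp [L, hi]
    · simp
  rw [hL]
  rw [TrivSqZeroExt.inlHom_apply, TrivSqZeroExt.inr_mul_inl, MulOpposite.smul_eq_mul_unop,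
    MulOpposite.unop_op, mooreDet]

end FirstOrder

section Moore

variable {R : Type*} [CommRing R] {d : ℕ}

/-- The complementary minors in the expansion of `mooreDet` along its first row. -/
def mooreMinor (q s : ℕ) (w : Fin d → R) (j : Fin (d + 1)) : R :=
  (Matrix.of fun i m : Fin d => w i ^ q ^ (2 * (s + (j.succAbove m).val) + 1)).det

theorem map_mooreDet {R' : Type*} [CommRing R'] (φ : R →+* R') (q s : ℕ) (y : R) (w : Fin d → R) :
    mooreDet q s (φ y) (fun j => φ (w j)) = φ (mooreDet q s y w) := by
  rw [mooreDet, mooreDet, RingHom.map_det]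
  congr 1
  ext i j
  refine Fin.cases ?_ (fun i => ?_) i <;> simp

theorem mooreDet_X (q s : ℕ) (w : Fin d → R) :
    mooreDet q s Polynomial.X (fun j => Polynomial.C (w j)) =
      ∑ j : Fin (d + 1), Polynomial.C ((-1) ^ j.val * mooreMinor q s w j) *
        Polynomial.X ^ q ^ (2 * (s + j.val) + 1) := by
  rw [mooreDet, Matrix.det_succ_row_zero]
  refine Finset.sum_congr rfl fun j _ => ?_
  have : (Matrix.of fun i j : Fin (d + 1) => (Fin.cons Polynomial.X (fun j => Polynomial.C (w j)) :
      Fin (d + 1) → Polynomial R) i ^ q ^ (2 * (s + j.val) + 1)).submatrix Fin.succ j.succAbove =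
      Polynomial.C.mapMatrix
        (Matrix.of fun i m : Fin d => w i ^ q ^ (2 * (s + (j.succAbove m).val) + 1)) := by
    ext1 i m
    simp
  rw [this, ← RingHom.map_det, mooreMinor]
  simp only [Matrix.of_apply, Fin.cons_zero, map_mul, map_pow, map_neg, map_one]
  ring

theorem coeff_mooreDet_X {q : ℕ} (hq : 2 ≤ q) (s : ℕ) (w : Fin d → R) :
    (mooreDet q s Polynomial.X (fun j => Polynomial.C (w j))).coeff (q ^ (2 * s + 1)) =
      mooreMinor q s w 0 := by
  rw [mooreDet_X, Polynomial.finsetSum_coeff, Finset.sum_eq_single 0]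
  · simp
  · intro j _ hj
    rw [Polynomial.coeff_C_mul_X_pow, if_neg]
    intro h
    have := Nat.pow_right_injective hq h
    have := Fin.val_ne_zero_iff.mpr hj
    omega
  · simp

theorem coeff_mooreDet_X_succ {q : ℕ} (hq : 2 ≤ q) (s : ℕ) (w : Fin d → R) :
    (mooreDet q (s + 1) Polynomial.X (fun j => Polynomial.C (w j))).coeff (q ^ (2 * s + 1)) =
      0 := by
  rw [mooreDet_X, Polynomial.finsetSum_coeff]
  refine Finset.sum_eq_zero fun j _ => ?_
  rw [Polynomial.coeff_C_mul_X_pow, if_neg]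
  intro h
  have := Nat.pow_right_injective hq h
  omega

theorem exists_mooreDet_X_succ_eq_expand (q s : ℕ) (w : Fin d → R) :
    ∃ β, mooreDet q (s + 1) Polynomial.X (fun j => Polynomial.C (w j)) =
      Polynomial.expand R (q ^ 2) β := by
  refine ⟨∑ j : Fin (d + 1), Polynomial.C ((-1) ^ j.val * mooreMinor q (s + 1) w j) *
    Polynomial.X ^ q ^ (2 * (s + j.val) + 1), ?_⟩
  rw [mooreDet_X, map_sum]
  refine Finset.sum_congr rfl fun j _ => ?_
  rw [map_mul (Polynomial.expand R (q ^ 2)), Polynomial.expand_C, map_pow (Polynomial.expand R _),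
    Polynomial.expand_X, ← pow_mul, ← pow_add]
  congr 3
  ring

theorem exists_mooreDet_X_zero_eq (q : ℕ) (w : Fin d → R) :
    ∃ β, mooreDet q 0 Polynomial.X (fun j => Polynomial.C (w j)) =
      Polynomial.C (mooreMinor q 0 w 0) * Polynomial.X ^ q + Polynomial.expand R (q ^ 2) β := by
  refine ⟨∑ j : Fin d, Polynomial.C ((-1) ^ (j.val + 1) * mooreMinor q 0 w j.succ) *
    Polynomial.X ^ q ^ (2 * j.val + 1), ?_⟩
  rw [mooreDet_X, map_sum, Fin.sum_univ_succ]
  congr 1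
  · simp
  refine Finset.sum_congr rfl fun j _ => ?_
  rw [map_mul (Polynomial.expand R (q ^ 2)), Polynomial.expand_C, map_pow (Polynomial.expand R _),
    Polynomial.expand_X, ← pow_mul, ← pow_add, Fin.val_succ]
  congr 3
  ring

end Moore

section GenericMoore

variable (k) (d : ℕ)

/-- The two generic first arguments of the determinants under consideration. -/
noncomputable def genY : Fin 2 → Polynomial (MvPolynomial (Fin (d + 1)) k) :=
  ![Polynomial.X, Polynomial.C (X 0)]

/-- The remaining generic arguments of the determinants under consideration. -/
noncomputable def genU (j : Fin d) : Polynomial (MvPolynomial (Fin (d + 1)) k) :=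
  Polynomial.C (X j.succ)

variable {k d}

theorem mooreMinor_ne_zero {q : ℕ} (hq : 2 ≤ q) (s : ℕ) :
    mooreMinor q s (fun j : Fin d => (X j.succ : MvPolynomial (Fin (d + 1)) k)) 0 ≠ 0 := by
  refine det_X_pow_ne_zero (fun j : Fin d => j.succ) (Fin.succ_injective d)
    (fun m => q ^ (2 * (s + ((0 : Fin (d + 1)).succAbove m).val) + 1)) fun a b h => ?_
  have := Nat.pow_right_injective hq h
  simp only [Fin.succAbove_zero, Fin.val_succ] at this
  omega

theorem mooreDet_genY_one {q : ℕ} (s : ℕ) :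
    mooreDet q s (genY k d 1) (genU k d) =
      Polynomial.C (mooreDet q s (X 0 : MvPolynomial (Fin (d + 1)) k) fun j => X j.succ) :=
  map_mooreDet Polynomial.C q s _ _

theorem mooreDet_generic_ne_zero {q : ℕ} (hq : 2 ≤ q) (s : ℕ) :
    mooreDet q s (X 0 : MvPolynomial (Fin (d + 1)) k) (fun j => X j.succ) ≠ 0 := by
  have h := det_X_pow_ne_zero (k := k) (fun j : Fin (d + 1) => j) Function.injective_id
    (fun m => q ^ (2 * (s + m.val) + 1)) fun a b h => by
      have := Nat.pow_right_injective hq h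
      omega
  convert h using 1
  rw [mooreDet]
  congr 1
  ext1 i j
  refine Fin.cases ?_ (fun i => ?_) i <;> simp

theorem det_genU_ne_zero {q : ℕ} (hq : 2 ≤ q) :
    (Matrix.of fun a m : Fin d => genU k d m ^ q ^ (2 * (a.val + 1))).det ≠ 0 := by
  have h := det_X_pow_ne_zero (k := k) (fun j : Fin d => j.succ) (Fin.succ_injective d)
    (fun m => q ^ (2 * (m.val + 1))) fun a b h => by
      have := Nat.pow_right_injective hq h
      omega
  rw [← Matrix.det_transpose]
  rw [← Polynomial.C_ne_zero, RingHom.map_det] at h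
  convert h using 2
  ext1 i j
  simp [genU]

theorem mooreDet_cross_ne_zero {q : ℕ} (hq : 2 ≤ q) (s : ℕ) :
    mooreDet q s (genY k d 0) (genU k d) * mooreDet q (s + 1) (genY k d 1) (genU k d) -
      mooreDet q s (genY k d 1) (genU k d) * mooreDet q (s + 1) (genY k d 0) (genU k d) ≠ 0 := by
  intro h
  have h2 := congr_arg (fun r => Polynomial.coeff r (q ^ (2 * s + 1))) h
  rw [mooreDet_genY_one, mooreDet_genY_one] at h2
  simp only [Polynomial.coeff_sub, Polynomial.coeff_mul_C, Polynomial.coeff_C_mul,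
    Polynomial.coeff_zero] at h2
  have h3 := coeff_mooreDet_X hq s (fun j : Fin d => (X j.succ : MvPolynomial (Fin (d + 1)) k))
  have h4 := coeff_mooreDet_X_succ hq s
    (fun j : Fin d => (X j.succ : MvPolynomial (Fin (d + 1)) k))
  change (mooreDet q s (genY k d 0) (genU k d)).coeff _ = _ at h3
  change (mooreDet q (s + 1) (genY k d 0) (genU k d)).coeff _ = _ at h4
  rw [h3, h4, mul_zero, sub_zero] at h2
  exact mul_ne_zero (mooreMinor_ne_zero hq s) (mooreDet_generic_ne_zero hq (s + 1)) h2

/-- A relation with coefficients in `k[y₀ ^ q²]` between three consecutive determinants is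
trivial. -/
theorem eq_zero_of_mooreDet_relation {q : ℕ} (hq : 2 ≤ q)
    {a b f : Polynomial (MvPolynomial (Fin (d + 1)) k)}
    (ha : ∃ β, a = Polynomial.expand _ (q ^ 2) β) (hb : ∃ β, b = Polynomial.expand _ (q ^ 2) β)
    (hf : ∃ β, f = Polynomial.expand _ (q ^ 2) β)
    (h : ∀ l, f * mooreDet q 2 (genY k d l) (genU k d) =
      a * mooreDet q 0 (genY k d l) (genU k d) + b * mooreDet q 1 (genY k d l) (genU k d)) :
    f = 0 := by
  obtain ⟨α, rfl⟩ := ha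
  obtain ⟨β, rfl⟩ := hb
  obtain ⟨γ, rfl⟩ := hf
  let w : Fin d → MvPolynomial (Fin (d + 1)) k := fun j => X j.succ
  obtain ⟨δ₀, h0⟩ := exists_mooreDet_X_zero_eq q w
  obtain ⟨δ₁, h1⟩ := exists_mooreDet_X_succ_eq_expand q 0 w
  obtain ⟨δ₂, h2⟩ := exists_mooreDet_X_succ_eq_expand q 1 w
  change mooreDet q 0 (genY k d 0) (genU k d) = _ at h0
  change mooreDet q 1 (genY k d 0) (genU k d) = _ at h1
  change mooreDet q 2 (genY k d 0) (genU k d) = _ at h2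
  have hα : α = 0 := by
    refine eq_zero_of_expand_add_X_pow (N := q ^ 2) (m := q) (by omega) (by nlinarith) α
      (γ * δ₂ - β * δ₁) δ₀ _ (mooreMinor_ne_zero hq 0) ?_
    have := h 0
    rw [h0, h1, h2] at this
    simp only [map_sub, map_mul]
    linear_combination this
  rw [hα] at h
  have hcross := mooreDet_cross_ne_zero (k := k) (d := d) hq 1
  refine (mul_eq_zero.mp ?_).resolve_right hcross
  have e0 := h 0
  have e1 := h 1
  rw [map_zero] at e0 e1
  linear_combination mooreDet q 1 (genY k d 0) (genU k d) * e1 -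
    mooreDet q 1 (genY k d 1) (genU k d) * e0

end GenericMoore

section Restriction

variable {d : ℕ}

/-- The restriction of a polynomial to the generic point of the subspace where the first two
coordinates vanish. -/
noncomputable def restrictZero (k : Type) [Field k] (d : ℕ) :
    MvPolynomial (Fin 2 ⊕ (Fin 2 ⊕ Fin d)) k →ₐ[k] Polynomial (MvPolynomial (Fin (d + 1)) k) :=
  aeval (Sum.elim 0 (Sum.elim (genY k d) (genU k d)))

theorem fst_firstOrder (l : Fin 2) (f : MvPolynomial (Fin 2 ⊕ (Fin 2 ⊕ Fin d)) k) :
    (firstOrder (genY k d) (genU k d) l f).fst = restrictZero k d f := by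
  suffices h : (TrivSqZeroExt.fstHom k (Polynomial (MvPolynomial (Fin (d + 1)) k))
      (Polynomial (MvPolynomial (Fin (d + 1)) k))).comp (firstOrder (genY k d) (genU k d) l) =
      restrictZero k d from DFunLike.congr_fun h f
  refine algHom_ext fun i => ?_
  rcases i with i | i | i
  · simp only [firstOrder, restrictZero, AlgHom.comp_apply, aeval_X, Sum.elim_inl]
    split_ifs <;> simp
  · simp [firstOrder, restrictZero]
  · simp [firstOrder, restrictZero]

theorem exists_eq_of_restrictZero_eq_zero {f : MvPolynomial (Fin 2 ⊕ (Fin 2 ⊕ Fin d)) k}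
    (hf : restrictZero k d f = 0) : ∃ m : Fin 2 → MvPolynomial (Fin 2 ⊕ (Fin 2 ⊕ Fin d)) k,
      f = X (Sum.inl 0) * m 0 + X (Sum.inl 1) * m 1 := by
  let I : Ideal (MvPolynomial (Fin 2 ⊕ (Fin 2 ⊕ Fin d)) k) :=
    Ideal.span {X (Sum.inl 0), X (Sum.inl 1)}
  let sec : Polynomial (MvPolynomial (Fin (d + 1)) k) →+*
      MvPolynomial (Fin 2 ⊕ (Fin 2 ⊕ Fin d)) k :=
    Polynomial.eval₂RingHom (aeval (Fin.cons (X (Sum.inr (Sum.inl 1)))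
      fun j => X (Sum.inr (Sum.inr j))) : MvPolynomial (Fin (d + 1)) k →ₐ[k]
        MvPolynomial (Fin 2 ⊕ (Fin 2 ⊕ Fin d)) k).toRingHom (X (Sum.inr (Sum.inl 0)))
  have hI : ∀ l : Fin 2, (X (Sum.inl l) : MvPolynomial (Fin 2 ⊕ (Fin 2 ⊕ Fin d)) k) ∈ I := by
    intro l
    fin_cases l
    · exact Ideal.subset_span (by simp)
    · exact Ideal.subset_span (by simp)
  have hsec : ((Ideal.Quotient.mk I).comp sec).comp (restrictZero k d).toRingHom =
      Ideal.Quotient.mk I := by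
    refine ringHom_ext (fun a => ?_) fun i => ?_
    · have : restrictZero k d (C a) = Polynomial.C (C a) := algHom_C _ _
      simp [this, sec]
    · rcases i with i | i | i
      · simpa [restrictZero] using (Ideal.Quotient.eq_zero_iff_mem.mpr (hI i)).symm
      · fin_cases i <;> simp [restrictZero, sec, genY]
      · simp [restrictZero, sec, genU]
  have h := DFunLike.congr_fun hsec f
  simp only [RingHom.comp_apply, AlgHom.toRingHom_eq_coe, RingHom.coe_coe, hf, map_zero] at h
  obtain ⟨a, b, hab⟩ := Ideal.mem_span_pair.mp (Ideal.Quotient.eq_zero_iff_mem.mp h.symm)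
  refine ⟨![a, b], ?_⟩
  rw [← hab]
  simp only [Matrix.cons_val_zero, Matrix.cons_val_one]
  ring

theorem snd_firstOrder (l : Fin 2) (m : Fin 2 → MvPolynomial (Fin 2 ⊕ (Fin 2 ⊕ Fin d)) k) :
    (firstOrder (genY k d) (genU k d) l (X (Sum.inl 0) * m 0 + X (Sum.inl 1) * m 1)).snd =
      restrictZero k d (m l) := by
  rw [← fst_firstOrder l]
  fin_cases l <;> simp [firstOrder]

/-- The Gram matrix of a hermitian form in a basis consisting of two dual pairs and a basis of
their orthogonal complement, the last vectors of the dual pairs being isotropic. -/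
def adaptedGram (F : Matrix (Fin 2) (Fin 2) k) (U : Matrix (Fin d) (Fin d) k) :
    Matrix (Fin 2 ⊕ (Fin 2 ⊕ Fin d)) (Fin 2 ⊕ (Fin 2 ⊕ Fin d)) k :=
  Matrix.fromBlocks F (Matrix.fromCols 1 0) (Matrix.fromRows 1 0) (Matrix.fromBlocks 0 0 0 U)

/-- The common factor of the first order terms of the Gram minors. -/
noncomputable def gramFactor (q : ℕ) (U : Matrix (Fin d) (Fin d) k) :
    Polynomial (MvPolynomial (Fin (d + 1)) k) :=
  (Matrix.of fun a m : Fin d => genU k d m ^ q ^ (2 * (a.val + 1))).det *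
    algebraMap k (Polynomial (MvPolynomial (Fin (d + 1)) k)) U.det

theorem gramFactor_ne_zero {q : ℕ} (hq : 2 ≤ q) {U : Matrix (Fin d) (Fin d) k}
    (hU : U.det ≠ 0) : gramFactor q U ≠ 0 :=
  mul_ne_zero (det_genU_ne_zero hq) ((map_ne_zero_iff _ (FaithfulSMul.algebraMap_injective _ _)).mpr hU)

theorem firstOrder_adaptedGram {q : ℕ} (hq : 2 ≤ q) (l : Fin 2)
    (F : Matrix (Fin 2) (Fin 2) k) (U : Matrix (Fin d) (Fin d) k) (s : ℕ) :
    firstOrder (genY k d) (genU k d) l (gramMinor q (adaptedGram F U) d s) =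
    TrivSqZeroExt.inr (gramFactor q U * mooreDet q s (genY k d l) (genU k d)) :=
  firstOrder_gramMinor hq _ _ l F U s

theorem snd_firstOrder_mul_gramMinor {q : ℕ} (hq : 2 ≤ q) (l : Fin 2)
    (F : Matrix (Fin 2) (Fin 2) k) (U : Matrix (Fin d) (Fin d) k) (s : ℕ)
    (f : MvPolynomial (Fin 2 ⊕ (Fin 2 ⊕ Fin d)) k) :
    (firstOrder (genY k d) (genU k d) l (f * gramMinor q (adaptedGram F U) d s)).snd =
      gramFactor q U * (restrictZero k d f * mooreDet q s (genY k d l) (genU k d)) := by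
  rw [map_mul, TrivSqZeroExt.snd_mul, firstOrder_adaptedGram hq, fst_firstOrder]
  simp only [TrivSqZeroExt.snd_inr, TrivSqZeroExt.fst_inr, MulOpposite.op_zero, zero_smul, add_zero,
    smul_eq_mul]
  ring

theorem exists_mul_gramMinor_mem {q : ℕ} (hq : 2 ≤ q)
    (F : Matrix (Fin 2) (Fin 2) k) {U : Matrix (Fin d) (Fin d) k} (hU : U.det ≠ 0) :
    ∃ f, restrictZero k d f ≠ 0 ∧ f * gramMinor q (adaptedGram F U) d 2 ∈
      Ideal.span {gramMinor q (adaptedGram F U) d 0, gramMinor q (adaptedGram F U) d 1} := by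
  have hzero : ∀ s, restrictZero k d (gramMinor q (adaptedGram F U) d s) = 0 := by
    intro s
    rw [← fst_firstOrder 0, firstOrder_adaptedGram hq, TrivSqZeroExt.fst_inr]
  choose m hm using fun s => exists_eq_of_restrictZero_eq_zero (hzero s)
  have hres : ∀ s l, restrictZero k d (m s l) =
      gramFactor q U * mooreDet q s (genY k d l) (genU k d) := by
    intro s l
    rw [← snd_firstOrder, ← hm, firstOrder_adaptedGram hq, TrivSqZeroExt.snd_inr]
  refine ⟨m 0 0 * m 1 1 - m 0 1 * m 1 0, ?_, ?_⟩
  · have h := mul_ne_zero (mul_ne_zero (gramFactor_ne_zero hq hU) (gramFactor_ne_zero hq hU))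
      (mooreDet_cross_ne_zero (k := k) (d := d) hq 0)
    convert h using 1
    simp only [map_sub, map_mul, hres]
    ring
  · rw [hm 0, hm 1, hm 2, Ideal.mem_span_pair]
    exact ⟨m 1 1 * m 2 0 - m 1 0 * m 2 1, m 0 0 * m 2 1 - m 0 1 * m 2 0, by ring⟩

end Restriction

section Orbit

/-- The coefficients of the orbit polynomial of an element of a stable ideal are invariant and
lie in the ideal; they do not all lie in a prime which does not contain the element. -/
theorem exists_invariant_mem_of_mem {H S : Type*} [Group H] [Finite H] [CommRing S]
    (φ : H → S →+* S) (hφ : ∀ g h x, φ (g * h) x = φ g (φ h x)) (hφ1 : ∀ x, φ 1 x = x)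
    (I P : Ideal S) [P.IsPrime] (hI : ∀ g, ∀ x ∈ I, φ g x ∈ I) {x : S} (hx : x ∈ I) (hxP : x ∉ P) :
    ∃ y ∈ I, y ∉ P ∧ ∀ g, φ g y = y := by
  classical
  have := Fintype.ofFinite H
  let χ : Polynomial S := ∏ g : H, (Polynomial.X - Polynomial.C (φ g x))
  have hdeg : ∀ Q : Ideal S, Q ≠ ⊤ → (χ.map (Ideal.Quotient.mk Q)).natDegree = Fintype.card H := by
    intro Q hQ
    have := Ideal.Quotient.nontrivial_iff.mpr hQ
    simp only [χ, Polynomial.map_prod, Polynomial.map_sub, Polynomial.map_X, Polynomial.map_C]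
    rw [Polynomial.natDegree_prod_of_monic _ _ fun b _ => Polynomial.monic_X_sub_C _]
    simp
  have hmonic : χ.Monic := Polynomial.monic_prod_of_monic _ _ fun b _ => Polynomial.monic_X_sub_C _
  have hinv : ∀ g i, φ g (χ.coeff i) = χ.coeff i := by
    intro g i
    rw [← Polynomial.coeff_map]
    congr 1
    simp only [χ, Polynomial.map_prod, Polynomial.map_sub, Polynomial.map_X, Polynomial.map_C,
      ← hφ]
    exact Fintype.prod_equiv (Equiv.mulLeft g) _ _ fun _ => rfl
  have hmem : ∀ i < Fintype.card H, χ.coeff i ∈ I := by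
    intro i hi
    have hmap : χ.map (Ideal.Quotient.mk I) = Polynomial.X ^ Fintype.card H := by
      simp only [χ, Polynomial.map_prod, Polynomial.map_sub, Polynomial.map_X, Polynomial.map_C,
        Ideal.Quotient.eq_zero_iff_mem.mpr (hI _ x hx), map_zero, sub_zero]
      simp
    rw [← Ideal.Quotient.eq_zero_iff_mem, ← Polynomial.coeff_map, hmap, Polynomial.coeff_X_pow,
      if_neg hi.ne]
  by_contra! hcon
  have hP : ∀ i < Fintype.card H, χ.coeff i ∈ P := by
    intro i hi
    by_contra h
    obtain ⟨g, hg⟩ := hcon _ (hmem i hi) h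
    exact hg (hinv g i)
  have hmapP : χ.map (Ideal.Quotient.mk P) = Polynomial.X ^ Fintype.card H := by
    have hd := hdeg P Ideal.IsPrime.ne_top'
    rw [(hmonic.map (Ideal.Quotient.mk P)).as_sum, hd, Finset.sum_eq_zero, add_zero]
    intro i hi
    rw [Polynomial.coeff_map, Ideal.Quotient.eq_zero_iff_mem.mpr (hP i (Finset.mem_range.mp hi)),
      map_zero, zero_mul]
  have hroot : (χ.map (Ideal.Quotient.mk P)).eval (Ideal.Quotient.mk P x) = 0 := by
    simp only [χ, Polynomial.map_prod, Polynomial.map_sub, Polynomial.map_X, Polynomial.map_C,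
      Polynomial.eval_prod, Polynomial.eval_sub, Polynomial.eval_X, Polynomial.eval_C]
    exact Finset.prod_eq_zero (Finset.mem_univ 1) (by rw [hφ1, sub_self])
  rw [hmapP, Polynomial.eval_pow, Polynomial.eval_X] at hroot
  exact hxP (Ideal.Quotient.eq_zero_iff_mem.mp (eq_zero_of_pow_eq_zero hroot))

end Orbit

section Transvection

variable {d : ℕ}

/-- The block unipotent matrices given by an alternating two by two block. -/
def unipotent (d q : ℕ) (b : k) :
    Matrix (Fin 2 ⊕ (Fin 2 ⊕ Fin d)) (Fin 2 ⊕ (Fin 2 ⊕ Fin d)) k :=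
  Matrix.fromBlocks 1 0 (Matrix.fromRows !![0, b; -b ^ q, 0] 0) 1

theorem det_unipotent (q : ℕ) (b : k) : (unipotent d q b).det = 1 := by
  simp [unipotent]

theorem unipotent_preserves_adaptedGram {p r q : ℕ} [Fact p.Prime] [CharP k p] (hq : q = p ^ r)
    (hk : ∀ x : k, x ^ q ^ 2 = x) (F : Matrix (Fin 2) (Fin 2) k) (U : Matrix (Fin d) (Fin d) k)
    (b : k) : (unipotent d q b)ᵀ * adaptedGram F U * (unipotent d q b).map (fun x => x ^ q) =
      adaptedGram F U := by
  have hq0 : q ≠ 0 := by rw [hq]; exact pow_ne_zero _ (Fact.out : p.Prime).ne_zero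
  have hneg : (-b ^ q) ^ q = -b := by
    have h : ∀ x : k, x ^ q = iterateFrobenius k p r x := fun x => by
      rw [iterateFrobenius_def, hq]
    rw [h (-b ^ q), map_neg, ← h, ← pow_mul, ← pow_two, hk]
  have hmap : (unipotent d q b).map (fun x => x ^ q) =
      Matrix.fromBlocks 1 0 (Matrix.fromRows !![0, b ^ q; -b, 0] 0) 1 := by
    have hone : ∀ {m : Type} [DecidableEq m], (1 : Matrix m m k).map (fun x => x ^ q) = 1 :=
      fun {m} _ => Matrix.map_one _ (zero_pow hq0) (one_pow q)
    rw [unipotent, Matrix.fromBlocks_map, hone, hone]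
    congr 1
    · ext i j; simp [hq0]
    · ext i j
      rcases i with i | i
      · fin_cases i <;> fin_cases j <;> simp [hq0, hneg]
      · simp [hq0]
  have hsum : !![0, b; -b ^ q, 0]ᵀ + !![0, b ^ q; -b, 0] = (0 : Matrix (Fin 2) (Fin 2) k) := by
    ext i j
    fin_cases i <;> fin_cases j <;> simp
  rw [hmap, unipotent, adaptedGram, Matrix.fromBlocks_transpose, Matrix.transpose_fromRows,
    Matrix.fromBlocks_multiply, Matrix.fromBlocks_multiply]
  simp only [Matrix.transpose_one, Matrix.transpose_zero, Matrix.one_mul, Matrix.zero_mul,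
    Matrix.mul_one, Matrix.mul_zero, zero_add, add_zero, Matrix.fromCols_mul_fromRows,
    Matrix.fromCols_mul_fromBlocks, Matrix.fromBlocks_mul_fromRows]
  congr 1
  · have hzero : (Matrix.fromCols 0 0 : Matrix (Fin 2) (Fin 2 ⊕ Fin d) k) = 0 := by
      ext i j
      rcases j with j | j <;> rfl
    rw [hzero, add_zero, Matrix.fromCols_mul_fromRows, Matrix.one_mul, Matrix.zero_mul, add_zero,
      add_assoc, hsum, add_zero]
  · simp
  · simp

/-- The restriction to the hyperplane `x₀ = 0`, as a polynomial in `y₀`. -/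
noncomputable def restrictHyperplane (k : Type) [Field k] (d : ℕ) :
    MvPolynomial (Fin 2 ⊕ (Fin 2 ⊕ Fin d)) k →ₐ[k]
      Polynomial (Polynomial (MvPolynomial (Fin (d + 1)) k)) :=
  aeval (Sum.elim ![0, Polynomial.C Polynomial.X]
    (Sum.elim ![Polynomial.X, Polynomial.C (Polynomial.C (X 0))]
      fun j => Polynomial.C (Polynomial.C (X j.succ))))

theorem exists_restrictZero_eq_expand [Fintype k] (q : ℕ)
    {f : MvPolynomial (Fin 2 ⊕ (Fin 2 ⊕ Fin d)) k}
    (hf : ∀ b : k, linSub (unipotent d q b) f = f) :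
    ∃ β, restrictZero k d f = Polynomial.expand _ (Fintype.card k) β := by
  let ev : Polynomial (MvPolynomial (Fin (d + 1)) k) →+* MvPolynomial (Fin (d + 1)) k :=
    Polynomial.constantCoeff
  have hmap : (restrictHyperplane k d f).map ev = restrictZero k d f := by
    suffices h : (Polynomial.mapRingHom ev).comp (restrictHyperplane k d).toRingHom =
        (restrictZero k d).toRingHom from DFunLike.congr_fun h f
    refine ringHom_ext (fun a => ?_) fun i => ?_
    · have h1 : restrictHyperplane k d (C a) = Polynomial.C (Polynomial.C (C a)) := algHom_C _ _
      have h2 : restrictZero k d (C a) = Polynomial.C (C a) := algHom_C _ _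
      simp [h1, h2, ev]
    · rcases i with i | i | i
      · fin_cases i <;> simp [restrictHyperplane, restrictZero, ev]
      · fin_cases i <;> simp [restrictHyperplane, restrictZero, ev, genY]
      · simp [restrictHyperplane, restrictZero, ev, genU]
  rw [← hmap]
  refine exists_map_eq_expand (k := k) Polynomial.X Polynomial.X_ne_zero ev (by simp [ev]) _
    fun b => ?_
  conv_rhs => rw [← hf b]
  suffices h : (Polynomial.compRingHom (Polynomial.X + Polynomial.C (b • Polynomial.X))).comp
      (restrictHyperplane k d).toRingHom =
      (restrictHyperplane k d).toRingHom.comp (linSub (unipotent d q b)).toRingHom from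
    DFunLike.congr_fun h f
  refine ringHom_ext (fun a => ?_) fun i => ?_
  · have h1 : restrictHyperplane k d (C a) = Polynomial.C (Polynomial.C (C a)) := algHom_C _ _
    have h2 : linSub (unipotent d q b) (C a) = C a := algHom_C _ _
    simp [h1, h2]
  · have hC : ∀ a, restrictHyperplane k d (C a) = Polynomial.C (Polynomial.C (C a)) :=
      fun a => algHom_C _ _
    have hXl : ∀ i, restrictHyperplane k d (X (Sum.inl i)) =
        (![0, Polynomial.C Polynomial.X] : Fin 2 → _) i := fun i => aeval_X _ _
    have hXm : ∀ i, restrictHyperplane k d (X (Sum.inr (Sum.inl i))) =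
        (![Polynomial.X, Polynomial.C (Polynomial.C (X 0))] : Fin 2 → _) i := fun i => aeval_X _ _
    have hXr : ∀ i, restrictHyperplane k d (X (Sum.inr (Sum.inr i))) =
        Polynomial.C (Polynomial.C (X i.succ)) := fun i => aeval_X _ _
    have hsmul : Polynomial.C (b • Polynomial.X : Polynomial (MvPolynomial (Fin (d + 1)) k)) =
        Polynomial.C (Polynomial.C (C b)) * Polynomial.C Polynomial.X := by
      rw [← Polynomial.C_mul]
      congr 1
      ext1 m
      simp [Polynomial.coeff_X, MvPolynomial.smul_eq_C_mul]
    simp only [RingHom.comp_apply, AlgHom.toRingHom_eq_coe, RingHom.coe_coe, linSub_X,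
      Fintype.sum_sum_type, Fin.sum_univ_two, hsmul]
    rcases i with i | i | i
    · fin_cases i <;> simp [hXl, unipotent]
    · fin_cases i <;> simp [hXl, hXm, hC, unipotent, add_comm,
        neg_zero (G := Polynomial (Polynomial (MvPolynomial (Fin (d + 1)) k)))]
    · simp [hXr, unipotent, Matrix.one_apply]

end Transvection

section AdaptedBasis

theorem exists_mul_pow_eq [Fintype k] {q : ℕ} (hq : 2 ≤ q) (hk : Fintype.card k = q ^ 2) (a : k)
    (ha : a ^ q = a) : ∃ c : k, c * c ^ q = a := by
  classical
  rcases eq_or_ne a 0 with rfl | h0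
  · exact ⟨0, zero_mul _⟩
  obtain ⟨g, hg⟩ := IsCyclic.exists_generator (α := kˣ)
  obtain ⟨m, hm⟩ := (Submonoid.mem_powers_iff _ _).mp
    (mem_powers_iff_mem_zpowers.mpr (hg (Units.mk0 a h0)))
  obtain ⟨t, rfl⟩ := Nat.exists_eq_add_of_le' (show 1 ≤ q by omega)
  have hord : orderOf g = (t + 1 + 1) * t := by
    rw [orderOf_eq_card_of_forall_mem_zpowers hg, Nat.card_eq_fintype_card, Fintype.card_units, hk]
    have : (t + 1) ^ 2 = (t + 1 + 1) * t + 1 := by ring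
    omega
  have hpow : g ^ (m * t) = 1 := by
    rw [pow_mul, hm, Units.ext_iff]
    rw [pow_succ] at ha
    simpa [h0] using ha
  obtain ⟨c, rfl⟩ : t + 1 + 1 ∣ m :=
    Nat.dvd_of_mul_dvd_mul_right (by omega) (hord ▸ orderOf_dvd_of_pow_eq_one hpow)
  refine ⟨(g ^ c : kˣ), ?_⟩
  have := congr_arg (Units.val) hm
  rw [Units.val_mk0] at this
  rw [← this, ← Units.val_pow_eq_pow_val, ← Units.val_mul]
  congr 1
  rw [← pow_mul, ← pow_add]
  congr 1
  ring

theorem exists_adapted_matrix [Fintype k] {p r q d : ℕ} [Fact p.Prime] [CharP k p]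
    (hq : q = p ^ r) (hq2 : 2 ≤ q) (hk : Fintype.card k = q ^ 2)
    (J : Matrix (Fin (d + 4)) (Fin (d + 4)) k) (hJherm : Jᵀ = J.map (fun x => x ^ q))
    (hJunit : IsUnit J) :
    ∃ (h : Matrix (Fin (d + 4)) (Fin 2 ⊕ (Fin 2 ⊕ Fin d)) k)
      (h' : Matrix (Fin 2 ⊕ (Fin 2 ⊕ Fin d)) (Fin (d + 4)) k)
      (F : Matrix (Fin 2) (Fin 2) k) (U : Matrix (Fin d) (Fin d) k), h * h' = 1 ∧ h' * h = 1 ∧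
      hᵀ * J * h.map (fun x => x ^ q) = adaptedGram F U ∧ U.det ≠ 0 := by
  let σ : k →+* k := iterateFrobenius k p r
  have hσ : (fun x : k => x ^ q) = σ := by
    ext x
    rw [hq]
    exact (iterateFrobenius_def p r x).symm
  have hσ2 : ∀ a, σ (σ a) = a := by
    intro a
    have h : ∀ x, σ x = x ^ q := fun x => (congr_fun hσ x).symm
    rw [h, h, ← pow_mul, ← pow_two, ← hk, FiniteField.pow_card]
  rw [hσ] at hJherm ⊢
  have hdet : IsUnit J.det := (Matrix.isUnit_iff_isUnit_det J).mp hJunit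
  let B : (Fin (d + 4) → k) →ₗ[k] (Fin (d + 4) → k) →ₛₗ[σ] k :=
    LinearMap.mk₂'ₛₗ (RingHom.id k) σ (fun v w => v ⬝ᵥ J *ᵥ fun i => σ (w i))
      (fun v v' w => add_dotProduct _ _ _)
      (fun c v w => smul_dotProduct _ _ _)
      (fun v w w' => by
        rw [← dotProduct_add, ← Matrix.mulVec_add]
        congr 2
        ext i
        simp)
      (fun c v w => by
        rw [← dotProduct_smul, ← Matrix.mulVec_smul]
        congr 2
        ext i
        simp)
  have hBdef : ∀ v w, B v w = v ⬝ᵥ J *ᵥ fun i => σ (w i) := fun v w => rfl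
  have hB : ∀ v w, B w v = σ (B v w) := by
    intro v w
    have h1 : σ (B v w) = (fun i => σ (v i)) ⬝ᵥ J.map σ *ᵥ w := by
      rw [hBdef, RingHom.map_dotProduct]
      congr 1
      ext i
      have hw : (σ ∘ fun j => σ (w j)) = w := funext fun j => hσ2 (w j)
      rw [Function.comp_apply, RingHom.map_mulVec, hw]
    rw [h1, ← hJherm, hBdef, Matrix.mulVec_transpose, dotProduct_comm, dotProduct_comm _ (w ᵥ* J),
      ← dotProduct_mulVec, dotProduct_comm]
  have hnd : ∀ v ≠ 0, ∃ w, B v w ≠ 0 := by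
    intro v hv
    by_contra! hcon
    refine hv ?_
    have h1 : v ᵥ* J = 0 := by
      ext j
      have h2 := hcon (Pi.single j 1)
      have h3 : (fun i => σ ((Pi.single j 1 : Fin (d + 4) → k) i)) = Pi.single j 1 := by
        ext i
        rcases eq_or_ne i j with rfl | hij
        · simp
        · simp [hij]
      rw [hBdef, h3, dotProduct_mulVec] at h2
      simpa using h2
    have h4 : v ᵥ* J ᵥ* J⁻¹ = 0 := by rw [h1, Matrix.zero_vecMul]
    rwa [Matrix.vecMul_vecMul, Matrix.mul_nonsing_inv _ hdet, Matrix.vecMul_one] at h4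
  have hnorm : ∀ a : k, σ a = a → ∃ c, c * σ c = a := by
    intro a ha
    rw [← hσ] at ha ⊢
    exact exists_mul_pow_eq hq2 hk a ha
  obtain ⟨f, e, u, hli, hee, hef, hue, huf⟩ :=
    exists_adapted_family B hσ2 hB hnd hnorm d (by simp)
  let b := basisOfLinearIndependentOfCardEqFinrank hli (by simp; omega)
  let h := (Pi.basisFun k (Fin (d + 4))).toMatrix b
  let h' := b.toMatrix (Pi.basisFun k (Fin (d + 4)))
  have hh' : h * h' = 1 := Module.Basis.toMatrix_mul_toMatrix_flip _ _
  have hh : h' * h = 1 := Module.Basis.toMatrix_mul_toMatrix_flip _ _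
  have hgram : ∀ i j, (hᵀ * J * h.map σ) i j =
      B (Sum.elim f (Sum.elim e u) i) (Sum.elim f (Sum.elim e u) j) := by
    intro i j
    rw [Matrix.mul_assoc, ← coe_basisOfLinearIndependentOfCardEqFinrank hli (by simp; omega)]
    rfl
  have hfe : ∀ i j, B (f i) (e j) = if i = j then 1 else 0 := by
    intro i j
    rw [hB (e j) (f i), hef]
    simp [eq_comm (a := i)]
  have heu : ∀ i j, B (e i) (u j) = 0 := fun i j => by rw [hB (u j) (e i), hue, map_zero]
  have hfu : ∀ i j, B (f i) (u j) = 0 := fun i j => by rw [hB (u j) (f i), huf, map_zero]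
  have hadapted : hᵀ * J * h.map σ =
      adaptedGram (Matrix.of fun i j => B (f i) (f j)) (Matrix.of fun i j => B (u i) (u j)) := by
    ext i j
    rw [hgram]
    rcases i with i | i | i <;> rcases j with j | j | j <;>
      simp [adaptedGram, hee, hef, hue, huf, hfe, heu, hfu, Matrix.one_apply]
  refine ⟨h, h', _, _, hh', hh, hadapted, fun hU => ?_⟩
  obtain ⟨v, hv, hv0⟩ := Matrix.exists_mulVec_eq_zero_iff.mpr hU
  have hinv : (h'.map σ * J⁻¹ * h'ᵀ) * (hᵀ * J * h.map σ) = 1 := by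
    have h1 : h'ᵀ * hᵀ = 1 := by rw [← Matrix.transpose_mul, hh', Matrix.transpose_one]
    have h2 : h'.map σ * h.map σ = 1 := by
      rw [← Matrix.map_mul, hh, Matrix.map_one _ (map_zero σ) (map_one σ)]
    calc _ = h'.map σ * (J⁻¹ * ((h'ᵀ * hᵀ) * J)) * h.map σ := by simp only [Matrix.mul_assoc]
      _ = 1 := by rw [h1, Matrix.one_mul, Matrix.nonsing_inv_mul _ hdet, Matrix.mul_one, h2]
  have hker : adaptedGram (Matrix.of fun i j => B (f i) (f j)) (Matrix.of fun i j => B (u i) (u j))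
      *ᵥ Sum.elim 0 (Sum.elim 0 v) = 0 := by
    rw [adaptedGram, Matrix.fromBlocks_mulVec]
    simp only [Sum.elim_comp_inl, Sum.elim_comp_inr, Matrix.fromBlocks_mulVec,
      Matrix.fromCols_mulVec_sumElim, hv0]
    ext i
    rcases i with i | i | i <;> simp
  have hzero : (Sum.elim 0 (Sum.elim 0 v) : Fin 2 ⊕ (Fin 2 ⊕ Fin d) → k) = 0 := by
    rw [← Matrix.one_mulVec (Sum.elim 0 (Sum.elim 0 v)), ← hinv, ← Matrix.mulVec_mulVec, hadapted,
      hker, Matrix.mulVec_zero]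
  exact hv (funext fun i => congr_fun hzero (Sum.inr (Sum.inr i)))

end AdaptedBasis

section Main

theorem mem_invariantRing_matSet {n : ℕ} {G : Subgroup (GL (Fin n) k)}
    {f : MvPolynomial (Fin n) k} :
    f ∈ invariantRing (matSet G) ↔ ∀ g ∈ G, linSub (g : Matrix (Fin n) (Fin n) k) f = f := by
  have h : ∀ g : GL (Fin n) k, polyAct (g : Matrix (Fin n) (Fin n) k) =
      linSub ((g⁻¹ : GL (Fin n) k) : Matrix (Fin n) (Fin n) k) := fun g => by
    rw [polyAct, ← Matrix.coe_units_inv]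
    rfl
  rw [mem_invariantRing]
  constructor
  · intro hf g hg
    have := hf _ ⟨g⁻¹, G.inv_mem hg, rfl⟩
    rwa [h, inv_inv] at this
  · rintro hf _ ⟨g, hg, rfl⟩
    rw [h]
    exact hf _ (G.inv_mem hg)

/-- Conjugates of the unipotent matrices lie in the special unitary group. -/
theorem conj_unipotent_mem_SUSet {p r q d : ℕ} [Fact p.Prime] [CharP k p] (hq : q = p ^ r)
    (hk : ∀ x : k, x ^ q ^ 2 = x) {J : Matrix (Fin (d + 4)) (Fin (d + 4)) k}
    {h : Matrix (Fin (d + 4)) (Fin 2 ⊕ (Fin 2 ⊕ Fin d)) k}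
    {h' : Matrix (Fin 2 ⊕ (Fin 2 ⊕ Fin d)) (Fin (d + 4)) k}
    {F : Matrix (Fin 2) (Fin 2) k} {U : Matrix (Fin d) (Fin d) k} (hh' : h * h' = 1)
    (hh : h' * h = 1) (hJ : hᵀ * J * h.map (fun x => x ^ q) = adaptedGram F U) (b : k) :
    h * unipotent d q b * h' ∈ SUSet (d + 4) q k J := by
  have hdet : (h * unipotent d q b * h').det = 1 := by
    rw [Matrix.det_conj_of_mul_eq_one hh' hh, det_unipotent]
  refine ⟨⟨(Matrix.isUnit_iff_isUnit_det _).mpr (by rw [hdet]; exact isUnit_one), ?_⟩, hdet⟩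
  have hρ := unipotent_preserves_adaptedGram hq hk F U b
  let σ : k →+* k := iterateFrobenius k p r
  have hσ : (fun x : k => x ^ q) = σ := by
    ext x
    rw [hq]
    exact (iterateFrobenius_def p r x).symm
  rw [hσ] at hJ hρ ⊢
  have h1 : h'ᵀ * hᵀ = 1 := by rw [← Matrix.transpose_mul, hh', Matrix.transpose_one]
  have h2 : h.map σ * h'.map σ = 1 := by
    rw [← Matrix.map_mul, hh', Matrix.map_one _ (map_zero σ) (map_one σ)]
  rw [Matrix.map_mul, Matrix.map_mul, Matrix.transpose_mul, Matrix.transpose_mul]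
  calc _ = h'ᵀ * ((unipotent d q b)ᵀ * (hᵀ * J * h.map σ) * (unipotent d q b).map σ) *
        h'.map σ := by simp only [Matrix.mul_assoc]
    _ = (h'ᵀ * hᵀ) * J * (h.map σ * h'.map σ) := by
      rw [hJ, hρ, ← hJ]; simp only [Matrix.mul_assoc]
    _ = J := by rw [h1, h2, Matrix.one_mul, Matrix.mul_one]

end Main

/-- For `n ≥ 4` and any group `G` with `SU_n(q) ≤ G ≤ GU_n(q)`, the action of
`G` on `V = k^n`, `k = F_{q²}`, does not have the direct summand property. -/
theorem unitary_not_directSummand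
    (p r : ℕ) [Fact p.Prime] (hr : 0 < r) (q : ℕ) (hq : q = p ^ r)
    (n : ℕ) (hn : 4 ≤ n)
    (k : Type) [Field k] [Fintype k] (hk : Fintype.card k = q ^ 2)
    (J : Matrix (Fin n) (Fin n) k) (hJherm : J.transpose = J.map (fun x => x ^ q))
    (hJunit : IsUnit J)
    (G : Subgroup (GL (Fin n) k))
    (hSU : ∀ g : GL (Fin n) k,
      ((g : GL (Fin n) k) : Matrix (Fin n) (Fin n) k) ∈ SUSet n q k J → g ∈ G)
    (hGU : ∀ g ∈ G,
      ((g : GL (Fin n) k) : Matrix (Fin n) (Fin n) k) ∈ GUSet n q k J) :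
    ¬ DirectSummand (matSet G) := by
  obtain ⟨d, rfl⟩ := Nat.exists_eq_add_of_le' hn
  have hq2 : 2 ≤ q := by
    rw [hq]
    exact (Fact.out : p.Prime).two_le.trans (Nat.le_self_pow hr.ne' p)
  have hchar : CharP k p := by
    refine (CharP.exists k).elim fun p' hp' => ?_
    obtain ⟨m, hp'prime, hcard⟩ := FiniteField.card k p'
    have hdvd : p' ∣ p := hp'prime.dvd_of_dvd_pow (n := r * 2) (by
      rw [pow_mul, ← hq, ← hk, hcard]
      exact dvd_pow_self p' m.ne_zero)
    rwa [(Nat.prime_dvd_prime_iff_eq hp'prime Fact.out).mp hdvd] at hp'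
  have hk2 : ∀ x : k, x ^ q ^ 2 = x := fun x => by rw [← hk, FiniteField.pow_card]
  obtain ⟨h, h', F, U, hh', hh, hJ, hU⟩ := exists_adapted_matrix hq hq2 hk J hJherm hJunit
  intro hS
  have hE : ∀ s, gramMinor q J d s ∈ invariantRing (matSet G) := fun s =>
    mem_invariantRing_matSet.mpr fun g hg => by
      rw [linSub_gramMinor hq hk2, (hGU g hg).2]
  have hEh : ∀ s, linSub h (gramMinor q J d s) = gramMinor q (adaptedGram F U) d s := fun s => by
    rw [linSub_gramMinor hq hk2, hJ]
  have hEh' : ∀ s, linSub h' (gramMinor q (adaptedGram F U) d s) = gramMinor q J d s := fun s => by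
    rw [← hEh, linSub_linSub, hh', linSub_one]
  let I : Ideal (MvPolynomial (Fin (d + 4)) k) := Submodule.comap
    (LinearMap.mulRight (MvPolynomial (Fin (d + 4)) k) (gramMinor q J d 2))
    (Ideal.span {gramMinor q J d 0, gramMinor q J d 1})
  have hI : ∀ x, x ∈ I ↔ ∃ a b, a * gramMinor q J d 0 + b * gramMinor q J d 1 =
      x * gramMinor q J d 2 := fun x => Ideal.mem_span_pair
  let P := RingHom.ker ((restrictZero k d).comp (linSub h)).toRingHom
  have hP : P.IsPrime := RingHom.ker_isPrime _
  obtain ⟨x, hx0, hx⟩ := exists_mul_gramMinor_mem hq2 F hU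
  obtain ⟨y, hyI, hyP, hy⟩ : ∃ y ∈ I, y ∉ P ∧ ∀ g : G,
      linSub ((g⁻¹ : GL (Fin (d + 4)) k) : Matrix (Fin (d + 4)) (Fin (d + 4)) k) y = y := by
    refine exists_invariant_mem_of_mem (H := G) (x := linSub h' x) (fun g => (linSub
      ((g⁻¹ : GL (Fin (d + 4)) k) : Matrix (Fin (d + 4)) (Fin (d + 4)) k)).toRingHom)
      ?_ ?_ I P ?_ ?_ ?_
    · intro g₁ g₂ f
      simp [linSub_linSub]
    · intro f
      simp [linSub_one]
    · intro g f hf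
      obtain ⟨a, b, hab⟩ := (hI f).mp hf
      have hg := fun s => mem_invariantRing_matSet.mp (hE s) _ (G.inv_mem g.2)
      have := congr_arg (linSub
        ((g⁻¹ : GL (Fin (d + 4)) k) : Matrix (Fin (d + 4)) (Fin (d + 4)) k)) hab
      simp only [map_add, map_mul, hg] at this
      exact (hI _).mpr ⟨_, _, this⟩
    · obtain ⟨a, b, hab⟩ := Ideal.mem_span_pair.mp hx
      have := congr_arg (linSub h') hab
      simp only [map_add, map_mul, hEh'] at this
      exact (hI _).mpr ⟨_, _, this⟩
    · intro hxP
      have : restrictZero k d (linSub h (linSub h' x)) = 0 := hxP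
      rw [linSub_linSub, hh, linSub_one] at this
      exact hx0 this
  have hyG : y ∈ invariantRing (matSet G) := mem_invariantRing_matSet.mpr fun g hg => by
    simpa using hy ⟨g⁻¹, G.inv_mem hg⟩
  obtain ⟨a, ha, b, hb, hab⟩ := hS.exists_invariant_coeff
    ((invariantRing (matSet G)).mul_mem hyG (hE 2)) (hE 0) (hE 1) hyI
  have hexpand : ∀ f ∈ invariantRing (matSet G),
      ∃ β, restrictZero k d (linSub h f) = Polynomial.expand _ (q ^ 2) β := by
    intro f hf
    rw [← hk]
    refine exists_restrictZero_eq_expand q fun c => ?_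
    have hmem := conj_unipotent_mem_SUSet hq hk2 hh' hh hJ c
    have hinv := mem_invariantRing_matSet.mp hf hmem.1.1.unit (hSU _ hmem)
    rw [IsUnit.unit_spec] at hinv
    conv_rhs => rw [← hinv]
    rw [linSub_linSub, linSub_linSub, Matrix.mul_assoc _ h' h, hh, Matrix.mul_one]
  refine hyP (eq_zero_of_mooreDet_relation hq2 (hexpand a ha) (hexpand b hb) (hexpand y hyG)
    fun l => ?_)
  refine mul_left_cancel₀ (gramFactor_ne_zero hq2 hU) ?_
  have hl := congr_arg (fun f => (firstOrder (genY k d) (genU k d) l (linSub h f)).snd) hab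
  simp only [map_add, map_mul (linSub h), hEh, TrivSqZeroExt.snd_add,
    snd_firstOrder_mul_gramMinor hq2] at hl
  change gramFactor q U * (restrictZero k d (linSub h y) * _) = _
  rw [hl, mul_add]
end
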